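/- Let 1 ≤ m < n be integers, let G ⊆ ℝⁿ be open and bounded, let S ⊆ ℝⁿ be closed with ℋ^m(S ∩ G) < ∞ and ℋ^m(S ∩ ∂G) = 0, and let ε > 0. Suppose S ∩ G = S_u ∪ S_r is a disjoint decomposition with S_u purely (ℋ^m,m)-unrectifiable and S_r countably (ℋ^m,m)-rectifiable. Then there exist a constant Γ ≥ 1 depending only on n and m, and a map g : ℝⁿ → ℝⁿ of class C^∞ which is an admissible deformation in G, such that ℋ^m(g[S_u]) ≤ ε·ℋ^m(S_u) and ℋ^m(g[S_r]) ≤ Γ·ℋ^m(S_r). -/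

import Mathlib

open Metric Set MeasureTheory

noncomputable section

/-- A set `A ⊆ ℝⁿ` is purely `(ℋ^m, m)`-unrectifiable if `ℋ^m (A ∩ g[ℝ^m]) = 0`
for every Lipschitz map `g : ℝ^m → ℝⁿ`. -/
def PurelyUnrectifiable (m : ℕ) {n : ℕ} (A : Set (EuclideanSpace ℝ (Fin n))) : Prop :=
  ∀ (g : EuclideanSpace ℝ (Fin m) → EuclideanSpace ℝ (Fin n)) (C : NNReal),
    LipschitzWith C g → μH[(m : ℝ)] (A ∩ Set.range g) = 0

/-- A set `A ⊆ ℝⁿ` is countably `(ℋ^m, m)`-rectifiable if there are countably many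
Lipschitz maps `gᵢ : ℝ^m → ℝⁿ` with `ℋ^m (A \ ⋃ᵢ gᵢ[ℝ^m]) = 0`. -/
def CountablyRectifiable (m : ℕ) {n : ℕ} (A : Set (EuclideanSpace ℝ (Fin n))) : Prop :=
  ∃ g : ℕ → EuclideanSpace ℝ (Fin m) → EuclideanSpace ℝ (Fin n),
    (∀ i, ∃ C : NNReal, LipschitzWith C (g i)) ∧
    μH[(m : ℝ)] (A \ ⋃ i, Set.range (g i)) = 0

/-- A basic deformation in an open set `W`. -/
def IsBasicDeformation {n : ℕ} (W : Set (EuclideanSpace ℝ (Fin n)))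
    (h : EuclideanSpace ℝ (Fin n) → EuclideanSpace ℝ (Fin n)) : Prop :=
  ContDiff ℝ 1 h ∧ ∃ V : Set (EuclideanSpace ℝ (Fin n)),
    IsOpen V ∧ Convex ℝ V ∧ Bornology.IsBounded V ∧ V ⊆ W ∧
    (∀ x ∉ V, h x = x) ∧ h '' V ⊆ V

/-- An admissible deformation in `W`: a finite composition of basic deformations in `W`. -/
def IsAdmissibleDeformation {n : ℕ} (W : Set (EuclideanSpace ℝ (Fin n)))
    (h : EuclideanSpace ℝ (Fin n) → EuclideanSpace ℝ (Fin n)) : Prop :=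
  ∃ L : List (EuclideanSpace ℝ (Fin n) → EuclideanSpace ℝ (Fin n)),
    (∀ g ∈ L, IsBasicDeformation W g) ∧ h = L.foldr (· ∘ ·) id

open scoped ENNReal NNReal Topology


/-- A set of finite Hausdorff measure whose density ratios at small scales stay below `θ < 1`
at all of its points is null. -/
theorem hausdorffMeasure_eq_zero_of_density_lt_one {X : Type*} [MetricSpace X]
    [MeasurableSpace X] [BorelSpace X] {d : ℝ} (hd : 0 < d) {C : Set X} (hC : μH[d] C ≠ ∞)
    {θ : ℝ≥0∞} (hθ : θ < 1) {δ : ℝ} (hδ : 0 < δ)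
    (h : ∀ a ∈ C, ∀ r : ℝ, 0 < r → r < δ →
      μH[d] (C ∩ closedBall a r) ≤ θ * ENNReal.ofReal r ^ d) :
    μH[d] C = 0 := by
  have hpiece : ∀ U : Set X, ediam U ≤ ENNReal.ofReal (δ / 2) →
      μH[d] (C ∩ U) ≤ θ * ⨆ (_ : U.Nonempty), ediam U ^ d := by
    intro U hU
    rcases (C ∩ U).eq_empty_or_nonempty with he | ⟨a, haC, haU⟩
    · simp [he]
    have hne : U.Nonempty := ⟨a, haU⟩
    have hfin : ediam U ≠ ∞ := (hU.trans_lt ENNReal.ofReal_lt_top).ne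
    simp only [hne, iSup_pos]
    rcases eq_or_ne (ediam U) 0 with h0 | h0
    · have hs : (C ∩ U).Subsingleton := by
        intro x hx y hy
        exact ediam_eq_zero_iff.1 h0 hx.2 hy.2
      have := Measure.nullSingletonClass_hausdorff X hd
      rw [hs.measure_zero]
      exact zero_le
    · have hpos : 0 < (ediam U).toReal := ENNReal.toReal_pos h0 hfin
      have hlt : (ediam U).toReal < δ := by
        have := ENNReal.toReal_mono ENNReal.ofReal_ne_top hU
        rw [ENNReal.toReal_ofReal (by positivity)] at this
        linarith
      have := h a haC _ hpos hlt
      rw [ENNReal.ofReal_toReal hfin] at this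
      refine (measure_mono ?_).trans this
      rintro x ⟨hxC, hxU⟩
      refine ⟨hxC, ?_⟩
      rw [mem_closedBall, dist_edist]
      exact ENNReal.toReal_mono hfin (edist_le_ediam_of_mem hxU haU)
  have key : μH[d] C ≤ θ * μH[d] C := by
    refine ENNReal.le_of_forall_pos_le_add fun ε hε _ => ?_
    have hlt : (⨅ (t : ℕ → Set X) (_ : C ⊆ ⋃ n, t n)
        (_ : ∀ n, ediam (t n) ≤ ENNReal.ofReal (δ / 2)),
        ∑' n, ⨆ (_ : (t n).Nonempty), ediam (t n) ^ d) < μH[d] C + ε := by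
      refine lt_of_le_of_lt ?_ (ENNReal.lt_add_right hC (by simpa using hε.ne'))
      conv_rhs => rw [Measure.hausdorffMeasure_apply]
      exact le_iSup₂_of_le (ENNReal.ofReal (δ / 2)) (by simpa using hδ) le_rfl
    simp only [iInf_lt_iff] at hlt
    obtain ⟨t, hCt, ht, hsum⟩ := hlt
    calc μH[d] C ≤ μH[d] (⋃ n, C ∩ t n) := by
          refine measure_mono fun x hx => ?_
          obtain ⟨n, hn⟩ := mem_iUnion.1 (hCt hx)
          exact mem_iUnion.2 ⟨n, hx, hn⟩
      _ ≤ ∑' n, μH[d] (C ∩ t n) := measure_iUnion_le _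
      _ ≤ ∑' n, θ * ⨆ (_ : (t n).Nonempty), ediam (t n) ^ d :=
          ENNReal.tsum_le_tsum fun n => hpiece _ (ht n)
      _ = θ * ∑' n, ⨆ (_ : (t n).Nonempty), ediam (t n) ^ d := ENNReal.tsum_mul_left
      _ ≤ θ * (μH[d] C + ε) := by gcongr
      _ = θ * μH[d] C + θ * ε := mul_add _ _ _
      _ ≤ θ * μH[d] C + ε := by
          gcongr
          exact mul_le_of_le_one_left (zero_le) hθ.le
  by_contra h0
  have : θ * μH[d] C < 1 * μH[d] C := ENNReal.mul_lt_mul_left h0 hC hθ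
  rw [one_mul] at this
  exact absurd key (not_le.2 this)

/-- Ball estimate for a set with few points in small cones around the fibres of `p`, none of
whose non-null subsets is a Lipschitz graph over its image under `p`. -/
theorem measure_inter_closedBall_le_of_cone {X : Type*} [MetricSpace X]
    [MeasurableSpace X] [BorelSpace X] {m : ℕ} {p : X → Fin m → ℝ} {K : ℝ≥0}
    (hp : LipschitzWith K p) (ν : Measure X) {C : Set X} {l s δ : ℝ} (hl : 0 ≤ l) (hs : 0 < s)
    (hs1 : s ≤ 1)
    (hC : ∀ D ⊆ C, ∀ c : ℝ, 0 < c → (∀ a ∈ D, ∀ b ∈ D, c * dist a b ≤ dist (p a) (p b)) →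
      ν D = 0)
    (hcone : ∀ a ∈ C, ∀ r : ℝ, 0 < r → r < δ →
      ν (C ∩ {x | x ≠ a ∧ dist x a ≤ r ∧ dist (p x) (p a) ≤ s * dist x a}) ≤
        ENNReal.ofReal (l * (r * s) ^ m))
    {a₀ : X} {ρ : ℝ} (hρ : 0 < ρ) (hρδ : 4 * ρ < δ) :
    ν (C ∩ closedBall a₀ ρ) ≤ ENNReal.ofReal (l * (2 * (40 * (K + 1)) ^ m) * ρ ^ m) := by
  set C' := C ∩ closedBall a₀ ρ with hC'
  set T : X → Set X := fun a => {x ∈ C' | x ≠ a ∧ dist (p x) (p a) ≤ s / 4 * dist x a} with hT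
  set D := {a ∈ C' | ¬ (T a).Nonempty} with hD
  have hD0 : ν D = 0 := by
    refine hC D (fun x hx => hx.1.1) (s / 4) (by positivity) fun a ha b hb => ?_
    by_contra hlt
    push Not at hlt
    refine hb.2 ⟨a, ha.1, ?_, hlt.le⟩
    rintro rfl
    simp at hlt
  have hdist : ∀ a ∈ C', ∀ b ∈ C', dist a b ≤ 2 * ρ := by
    intro a ha b hb
    have h1 := mem_closedBall.1 ha.2
    have h2 := mem_closedBall.1 hb.2
    linarith [dist_triangle_right a b a₀]
  set hh : X → ℝ := fun a => sSup ((fun x => dist x a) '' T a) with hhh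
  have hbdd : ∀ a ∈ C', BddAbove ((fun x => dist x a) '' T a) := by
    intro a ha
    refine ⟨2 * ρ, ?_⟩
    rintro _ ⟨x, hx, rfl⟩
    exact hdist x hx.1 a ha
  have hle : ∀ a ∈ C', ∀ x ∈ T a, dist x a ≤ hh a := fun a ha x hx =>
    le_csSup (hbdd a ha) ⟨x, hx, rfl⟩
  have hpos : ∀ a ∈ C' \ D, 0 < hh a := by
    rintro a ⟨ha, haD⟩
    have : (T a).Nonempty := by
      by_contra hn
      exact haD ⟨ha, hn⟩
    obtain ⟨x, hx⟩ := this
    exact (dist_pos.2 hx.2.1).trans_le (hle a ha x hx)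
  have hh2 : ∀ a ∈ C', hh a ≤ 2 * ρ := by
    intro a ha
    refine Real.sSup_le ?_ (by positivity)
    rintro _ ⟨x, hx, rfl⟩
    exact hdist x hx.1 a ha
  have htube : ∀ a ∈ C' \ D, ν (C' ∩ {x | dist (p x) (p a) ≤ s * hh a / 4}) ≤
      ENNReal.ofReal (2 * l * (2 * hh a * s) ^ m) := by
    rintro a haD
    have ha := haD.1
    have hp0 := hpos a haD
    obtain ⟨b, hbT, hb⟩ : ∃ b ∈ T a, 3 / 4 * hh a < dist b a := by
      have hne : ((fun x => dist x a) '' T a).Nonempty := by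
        by_contra hn
        rw [image_nonempty] at hn
        exact haD.2 ⟨ha, hn⟩
      obtain ⟨_, ⟨b, hb, rfl⟩, hlt⟩ := exists_lt_of_lt_csSup hne
        (show 3 / 4 * hh a < sSup ((fun x => dist x a) '' T a) by
          change 3 / 4 * hh a < hh a; linarith)
      exact ⟨b, hb, hlt⟩
    have hr : 2 * hh a < δ := by linarith [hh2 a ha]
    have hsub : C' ∩ {x | dist (p x) (p a) ≤ s * hh a / 4} ⊆
        (C ∩ {x | x ≠ a ∧ dist x a ≤ 2 * hh a ∧ dist (p x) (p a) ≤ s * dist x a}) ∪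
        (C ∩ {x | x ≠ b ∧ dist x b ≤ 2 * hh a ∧ dist (p x) (p b) ≤ s * dist x b}) := by
      rintro x ⟨hx, hpx⟩
      rw [mem_ofPred_eq] at hpx
      have hxa : dist x a ≤ hh a := by
        by_contra hlt
        push Not at hlt
        refine absurd (hle a ha x ⟨hx, ?_, ?_⟩) (not_le.2 hlt)
        · rintro rfl
          rw [dist_self] at hlt
          linarith
        · refine hpx.trans ?_
          nlinarith
      rcases le_or_gt (hh a / 4) (dist x a) with hc | hc
      · left
        refine ⟨hx.1, ?_, by linarith, ?_⟩
        · rintro rfl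
          rw [dist_self] at hc
          linarith
        · refine hpx.trans ?_
          nlinarith
      · right
        have hba := hle a ha b hbT
        have h1 : hh a / 2 < dist x b := by
          have := dist_triangle_left b a x
          linarith
        have h2 : dist x b ≤ 2 * hh a := by
          have := dist_triangle_right x b a
          linarith
        refine ⟨hx.1, ?_, h2, ?_⟩
        · rintro rfl
          rw [dist_self] at h1
          linarith
        · have h3 := dist_triangle_right (p x) (p b) (p a)
          have h4 := hbT.2.2
          have h5 : s / 4 * dist b a ≤ s / 4 * hh a := by gcongr
          have h6 : s * (hh a / 2) ≤ s * dist x b := by gcongr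
          linarith
    refine (measure_mono hsub).trans ((measure_union_le _ _).trans ?_)
    refine (add_le_add (hcone a ha.1 _ (by linarith) hr) (hcone b hbT.1.1 _ (by linarith) hr)).trans
      ?_
    rw [← ENNReal.ofReal_add (by positivity) (by positivity)]
    exact ENNReal.ofReal_le_ofReal (by linarith)
  obtain ⟨u, huD, hdisj, hcov⟩ :=
    Vitali.exists_disjoint_subfamily_covering_enlargement_closedBall (C' \ D) p
      (fun a => s * hh a / 20) (s * (2 * ρ) / 20)
      (fun a ha => by have := hh2 a ha.1; gcongr) 5 (by norm_num)
  have hucount : u.Countable := by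
    refine hdisj.countable_of_nonempty_interior fun a ha => ?_
    have := hpos a (huD ha)
    exact ⟨p a, ball_subset_interior_closedBall (mem_ball_self (by positivity))⟩
  rcases C'.eq_empty_or_nonempty with he | ⟨c₀, hc₀⟩
  · rw [he]; simp
  have hvol : ∑' a : u, volume (closedBall (p a) (s * hh a / 20)) ≤
      ENNReal.ofReal ((2 * ((K + 1) * ρ)) ^ m) := by
    have hcard : (2 * ((K + 1 : ℝ) * ρ)) ^ m = (2 * ((K + 1 : ℝ) * ρ)) ^ Fintype.card (Fin m) := by
      simp
    rw [hcard, ← Real.volume_pi_closedBall (p a₀) (by positivity)]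
    rw [← measure_biUnion hucount hdisj (fun a _ => measurableSet_closedBall)]
    refine measure_mono (iUnion₂_subset fun a hau => closedBall_subset_closedBall' ?_)
    have h1 := hh2 a (huD hau).1
    have h2 := hp.dist_le_mul a a₀
    have h3 := mem_closedBall.1 (huD hau).1.2
    have h4 : (K : ℝ) * dist a a₀ ≤ K * ρ := by gcongr
    have h5 : s * hh a ≤ 1 * (2 * ρ) := by
      have := (hpos a (huD hau)).le
      gcongr
    linarith
  calc ν C' ≤ ν (D ∪ ⋃ a ∈ u, C' ∩ {x | dist (p x) (p a) ≤ s * hh a / 4}) := by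
        refine measure_mono fun x hx => ?_
        by_cases hxD : x ∈ D
        · exact Or.inl hxD
        · right
          obtain ⟨b, hb, hsub⟩ := hcov x ⟨hx, hxD⟩
          have := hpos x ⟨hx, hxD⟩
          have h1 := hsub (mem_closedBall_self (by positivity))
          refine mem_iUnion₂.2 ⟨b, hb, hx, ?_⟩
          rw [mem_closedBall] at h1
          rw [mem_ofPred_eq]
          linarith
    _ ≤ 0 + ∑' a : u, ν (C' ∩ {x | dist (p x) (p a) ≤ s * hh a / 4}) := by
        refine (measure_union_le _ _).trans ?_
        rw [hD0]
        gcongr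
        exact measure_biUnion_le _ hucount _
    _ ≤ ∑' a : u, ENNReal.ofReal (2 * l * 20 ^ m) * volume (closedBall (p a) (s * hh a / 20)) := by
        rw [zero_add]
        refine ENNReal.tsum_le_tsum fun a => (htube a (huD a.2)).trans ?_
        have := hpos a (huD a.2)
        rw [Real.volume_pi_closedBall _ (by positivity), ← ENNReal.ofReal_mul (by positivity)]
        refine ENNReal.ofReal_le_ofReal (le_of_eq ?_)
        rw [Fintype.card_fin, mul_assoc (2 * l), ← mul_pow]
        congr 2
        ring
    _ = ENNReal.ofReal (2 * l * 20 ^ m) * ∑' a : u, volume (closedBall (p a) (s * hh a / 20)) :=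
        ENNReal.tsum_mul_left
    _ ≤ ENNReal.ofReal (2 * l * 20 ^ m) * ENNReal.ofReal ((2 * ((K + 1) * ρ)) ^ m) := by gcongr
    _ = ENNReal.ofReal (l * (2 * (40 * (K + 1)) ^ m) * ρ ^ m) := by
        rw [← ENNReal.ofReal_mul (by positivity)]
        congr 1
        rw [show (2 * (((K : ℝ) + 1) * ρ)) = 2 * (K + 1) * ρ by ring,
          show (40 * ((K : ℝ) + 1)) = 20 * (2 * (K + 1)) by ring, mul_pow _ ρ,
          mul_pow 20]
        ring

/-- A subset of a purely unrectifiable set that is a Lipschitz graph over its image under `p`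
is null. -/
theorem PurelyUnrectifiable.measure_eq_zero_of_expanding {n m : ℕ}
    {E : Set (EuclideanSpace ℝ (Fin n))} (hE : PurelyUnrectifiable m E)
    (p : EuclideanSpace ℝ (Fin n) → Fin m → ℝ) {D : Set (EuclideanSpace ℝ (Fin n))} (hDE : D ⊆ E)
    {c : ℝ} (hc : 0 < c) (h : ∀ a ∈ D, ∀ b ∈ D, c * dist a b ≤ dist (p a) (p b)) :
    μH[(m : ℝ)] D = 0 := by
  have hinj : InjOn p D := by
    intro a ha b hb hab
    have := h a ha b hb
    rw [hab, dist_self] at this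
    by_contra hne
    have := mul_pos hc (dist_pos.2 hne)
    linarith
  have hlip : LipschitzOnWith (Real.toNNReal c⁻¹) (Function.invFunOn p D) (p '' D) := by
    refine LipschitzOnWith.of_dist_le_mul ?_
    rintro _ ⟨a, ha, rfl⟩ _ ⟨b, hb, rfl⟩
    rw [hinj.leftInvOn_invFunOn ha, hinj.leftInvOn_invFunOn hb,
      Real.coe_toNNReal _ (inv_nonneg.2 hc.le)]
    have := h a ha b hb
    rw [inv_mul_eq_div, le_div_iff₀ hc]
    linarith
  obtain ⟨g, hg, hgeq⟩ := hlip.extend_finite_dimension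
  have hG := hg.comp (PiLp.lipschitzWith_ofLp 2 (fun _ : Fin m => ℝ))
  refine measure_mono_null (fun x hx => ?_) (hE _ _ hG)
  refine ⟨hDE hx, WithLp.toLp 2 (p x), ?_⟩
  change g (p x) = x
  rw [← hgeq (mem_image_of_mem p hx), hinj.leftInvOn_invFunOn hx]

theorem EuclideanSpace.exists_dist_le_card_mul {n : ℕ} {x a : EuclideanSpace ℝ (Fin n)}
    (h : x ≠ a) : ∃ j, dist x a ≤ n * |x j - a j| := by
  by_contra! hlt
  have hD : 0 < dist x a := dist_pos.2 h
  have hn : Nonempty (Fin n) := by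
    by_contra hn
    rw [not_nonempty_iff] at hn
    exact h (Subsingleton.elim _ _)
  have hn1 : (1 : ℝ) ≤ n := by
    have : 0 < n := Fin.pos_iff_nonempty.2 hn
    exact_mod_cast this
  have h1 : ∑ j, dist (x j) (a j) ^ 2 < ∑ _j : Fin n, (dist x a / n) ^ 2 := by
    refine Finset.sum_lt_sum_of_nonempty Finset.univ_nonempty fun j _ => ?_
    have := hlt j
    rw [Real.dist_eq]
    have h3 : |x j - a j| < dist x a / n := by
      rw [lt_div_iff₀ (by linarith)]
      linarith
    gcongr
  have h2 : dist x a ^ 2 = ∑ j, dist (x j) (a j) ^ 2 := by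
    rw [EuclideanSpace.dist_eq, Real.sq_sqrt (Finset.sum_nonneg fun _ _ => sq_nonneg _)]
  rw [← h2, Finset.sum_const, Finset.card_univ, Fintype.card_fin, nsmul_eq_mul, div_pow,
    ← mul_div_assoc, lt_div_iff₀ (by positivity)] at h1
  have h3 : 0 < dist x a ^ 2 := by positivity
  nlinarith [mul_le_mul_of_nonneg_left hn1 (by positivity : (0 : ℝ) ≤ n * dist x a ^ 2)]

/-- The set of points of a purely unrectifiable set at which the measure of thin cones around the
fibres of `p` is small, uniformly in the scale, is null. -/
theorem PurelyUnrectifiable.measure_eq_zero_of_cone {n m : ℕ} (hm : 1 ≤ m)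
    {E : Set (EuclideanSpace ℝ (Fin n))} (hE : PurelyUnrectifiable m E)
    (hfin : μH[(m : ℝ)] E ≠ ∞) {p : EuclideanSpace ℝ (Fin n) → Fin m → ℝ} {K : ℝ≥0}
    (hp : LipschitzWith K p) {C : Set (EuclideanSpace ℝ (Fin n))} (hCE : C ⊆ E)
    (hcone : ∀ a ∈ C, ∃ L : ℕ, ∀ q : ℝ, 0 < q → ∃ k : ℕ, ∀ i ≥ L, ∀ j : Fin n,
      (μH[(m : ℝ)].restrict E) {x | dist x a ≤ (1 / 2) ^ i ∧ x j ≠ a j ∧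
        dist (p x) (p a) ≤ (1 / 2) ^ k * |x j - a j|} ≤
        ENNReal.ofReal (q * ((1 / 2 : ℝ) ^ (i + k)) ^ m)) :
    μH[(m : ℝ)] C = 0 := by
  set c₀ : ℝ := n * (2 * n) ^ m * (2 * (40 * (K + 1)) ^ m) with hc₀
  have hc₀0 : 0 ≤ c₀ := by positivity
  set q : ℝ := 1 / (2 * (c₀ + 1)) with hq
  have hq0 : 0 < q := by positivity
  have hqc : c₀ * q < 1 := by
    rw [hq, mul_one_div, div_lt_one (by positivity)]
    linarith
  have hsub : C ⊆ ⋃ L : ℕ, ⋃ k : ℕ, {a ∈ C | ∀ i ≥ L, ∀ j : Fin n,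
      (μH[(m : ℝ)].restrict E) {x | dist x a ≤ (1 / 2) ^ i ∧ x j ≠ a j ∧
        dist (p x) (p a) ≤ (1 / 2) ^ k * |x j - a j|} ≤
        ENNReal.ofReal (q * ((1 / 2 : ℝ) ^ (i + k)) ^ m)} := by
    intro a ha
    obtain ⟨L, hL⟩ := hcone a ha
    obtain ⟨k, hk⟩ := hL q hq0
    exact mem_iUnion₂.2 ⟨L, k, ha, hk⟩
  refine measure_mono_null hsub (measure_iUnion_null fun L => measure_iUnion_null fun k => ?_)
  set C' := {a ∈ C | ∀ i ≥ L, ∀ j : Fin n,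
      (μH[(m : ℝ)].restrict E) {x | dist x a ≤ (1 / 2) ^ i ∧ x j ≠ a j ∧
        dist (p x) (p a) ≤ (1 / 2) ^ k * |x j - a j|} ≤
        ENNReal.ofReal (q * ((1 / 2 : ℝ) ^ (i + k)) ^ m)} with hC'
  have hC'C : C' ⊆ C := fun a ha => ha.1
  rcases Nat.eq_zero_or_pos n with hn0 | hn0
  · subst hn0
    have hs : C'.Subsingleton := subsingleton_of_subsingleton
    have := Measure.nullSingletonClass_hausdorff (EuclideanSpace ℝ (Fin 0))
      (show (0 : ℝ) < m by exact_mod_cast hm)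
    exact hs.measure_zero _
  have hn1 : (1 : ℝ) ≤ n := by exact_mod_cast hn0
  set s : ℝ := (1 / 2) ^ k / n with hs
  have hs0 : 0 < s := by positivity
  have hs1 : s ≤ 1 := by
    rw [hs, div_le_one (by linarith)]
    exact (pow_le_one₀ (by norm_num) (by norm_num)).trans hn1
  have hball : ∀ a ∈ C', ∀ r : ℝ, 0 < r → r < (1 / 2) ^ L →
      μH[(m : ℝ)] (C' ∩ {x | x ≠ a ∧ dist x a ≤ r ∧ dist (p x) (p a) ≤ s * dist x a}) ≤
        ENNReal.ofReal ((n * q * (2 * n) ^ m) * (r * s) ^ m) := by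
    intro a ha r hr hrL
    have hr1 : r ≤ 1 := hrL.le.trans (pow_le_one₀ (by norm_num) (by norm_num))
    obtain ⟨i, hi1, hi2⟩ := exists_nat_pow_near_of_lt_one hr hr1 (by norm_num : (0 : ℝ) < 1 / 2)
      (by norm_num)
    have hiL : L ≤ i := by
      have := (pow_lt_pow_iff_right_of_lt_one₀ (by norm_num : (0 : ℝ) < 1 / 2)
        (by norm_num)).1 (hi1.trans hrL)
      omega
    have h1 : C' ∩ {x | x ≠ a ∧ dist x a ≤ r ∧ dist (p x) (p a) ≤ s * dist x a} ⊆
        ⋃ j : Fin n, {x | dist x a ≤ (1 / 2) ^ i ∧ x j ≠ a j ∧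
        dist (p x) (p a) ≤ (1 / 2) ^ k * |x j - a j|} ∩ E := by
      rintro x ⟨hxC, hxa, hxr, hxp⟩
      obtain ⟨j, hj⟩ := EuclideanSpace.exists_dist_le_card_mul hxa
      have hj0 : x j ≠ a j := by
        intro h0
        rw [h0, sub_self, abs_zero, mul_zero] at hj
        exact absurd (dist_pos.2 hxa) (not_lt.2 hj)
      refine mem_iUnion.2 ⟨j, ⟨hxr.trans hi2, hj0, hxp.trans ?_⟩, hCE (hC'C hxC)⟩
      calc s * dist x a ≤ s * (n * |x j - a j|) := by gcongr
        _ = (1 / 2) ^ k * |x j - a j| := by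
          rw [hs]
          field_simp
    calc _ ≤ ∑ j : Fin n, μH[(m : ℝ)] ({x | dist x a ≤ (1 / 2) ^ i ∧ x j ≠ a j ∧
            dist (p x) (p a) ≤ (1 / 2) ^ k * |x j - a j|} ∩ E) :=
          (measure_mono h1).trans (measure_iUnion_fintype_le _ _)
      _ ≤ ∑ _j : Fin n, ENNReal.ofReal (q * ((1 / 2 : ℝ) ^ (i + k)) ^ m) :=
          Finset.sum_le_sum fun j _ => (Measure.le_restrict_apply _ _).trans (ha.2 i hiL j)
      _ = ENNReal.ofReal (n * (q * ((1 / 2 : ℝ) ^ (i + k)) ^ m)) := by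
          rw [Finset.sum_const, Finset.card_univ, Fintype.card_fin, nsmul_eq_mul,
            ENNReal.ofReal_mul (p := (n : ℝ)) (by positivity), ENNReal.ofReal_natCast]
      _ ≤ _ := by
          refine ENNReal.ofReal_le_ofReal ?_
          have h2 : (1 / 2 : ℝ) ^ (i + k) ≤ 2 * n * (r * s) := by
            have h3 : (1 / 2 : ℝ) ^ i ≤ 2 * r := by
              rw [pow_succ] at hi1
              linarith
            calc (1 / 2 : ℝ) ^ (i + k) = (1 / 2) ^ i * (1 / 2) ^ k := pow_add _ _ _
              _ ≤ 2 * r * (1 / 2) ^ k := by gcongr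
              _ = 2 * n * (r * s) := by
                rw [hs]
                field_simp
          calc n * (q * ((1 / 2 : ℝ) ^ (i + k)) ^ m) ≤ n * (q * (2 * n * (r * s)) ^ m) := by gcongr
            _ = _ := by
              rw [mul_pow]
              ring
  have hfin' : μH[(m : ℝ)] C' ≠ ∞ :=
    ((measure_mono (hC'C.trans hCE)).trans_lt hfin.lt_top).ne
  refine hausdorffMeasure_eq_zero_of_density_lt_one (by exact_mod_cast hm) hfin'
    (θ := ENNReal.ofReal (c₀ * q)) (by simpa using hqc) (δ := (1 / 2) ^ L / 4)
    (by positivity) fun a ha ρ hρ hρL => ?_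
  refine (measure_inter_closedBall_le_of_cone hp _ (by positivity) hs0 hs1
    (fun D hD c hc h => hE.measure_eq_zero_of_expanding p (hD.trans (hC'C.trans hCE)) hc h)
    hball hρ (by linarith)).trans ?_
  rw [ENNReal.ofReal_rpow_of_nonneg hρ.le (by positivity), ← ENNReal.ofReal_mul (by positivity),
    Real.rpow_natCast]
  refine ENNReal.ofReal_le_ofReal (le_of_eq ?_)
  rw [hc₀]
  ring

theorem hausdorffMeasure_fin_real (m : ℕ) : (μH[(m : ℝ)] : Measure (Fin m → ℝ)) = volume := by
  have := hausdorffMeasure_pi_real (ι := Fin m)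
  rwa [Fintype.card_fin] at this

/-- If the image of `ν` under `p` has large density ratios at all points of `p '' D`, then
`p '' D` is a null set. -/
theorem volume_image_eq_zero_of_infinite_density {X : Type*} [MeasurableSpace X] {m : ℕ}
    {p : X → Fin m → ℝ} (hp : Measurable p) (ν : Measure X) [IsFiniteMeasure ν] {D : Set X}
    (h : ∀ a ∈ D, ∀ q : ℕ, ∃ r : ℝ, 0 < r ∧ r ≤ 1 ∧
      q * ENNReal.ofReal (r ^ m) ≤ ν (p ⁻¹' closedBall (p a) r)) :
    volume (p '' D) = 0 := by
  have key : ∀ q : ℕ, q * volume (p '' D) ≤ ENNReal.ofReal (10 ^ m) * ν univ := by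
    intro q
    choose! r hr0 hr1 hr using fun a ha => h a ha q
    obtain ⟨u, huD, hdisj, hcov⟩ :=
      Vitali.exists_disjoint_subfamily_covering_enlargement_closedBall D p r 1 hr1 5 (by norm_num)
    have hucount : u.Countable := hdisj.countable_of_nonempty_interior fun a ha =>
      ⟨p a, ball_subset_interior_closedBall (mem_ball_self (hr0 a (huD ha)))⟩
    have h1 : volume (p '' D) ≤
        ENNReal.ofReal (10 ^ m) * ∑' a : u, ENNReal.ofReal (r a ^ m) := by
      calc volume (p '' D) ≤ volume (⋃ b ∈ u, closedBall (p b) (5 * r b)) := by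
            refine measure_mono ?_
            rintro _ ⟨a, ha, rfl⟩
            obtain ⟨b, hb, hsub⟩ := hcov a ha
            exact mem_iUnion₂.2 ⟨b, hb, hsub (mem_closedBall_self (hr0 a ha).le)⟩
        _ ≤ ∑' b : u, volume (closedBall (p b) (5 * r b)) := measure_biUnion_le _ hucount _
        _ = ∑' b : u, ENNReal.ofReal (10 ^ m) * ENNReal.ofReal (r b ^ m) := by
            refine tsum_congr fun b => ?_
            have := hr0 b (huD b.2)
            rw [Real.volume_pi_closedBall _ (by positivity), Fintype.card_fin,
              ← ENNReal.ofReal_mul (by positivity), ← mul_pow]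
            congr 2
            ring
        _ = _ := ENNReal.tsum_mul_left
    calc q * volume (p '' D)
        ≤ q * (ENNReal.ofReal (10 ^ m) * ∑' a : u, ENNReal.ofReal (r a ^ m)) := by gcongr
      _ = ENNReal.ofReal (10 ^ m) * ∑' a : u, q * ENNReal.ofReal (r a ^ m) := by
          rw [ENNReal.tsum_mul_left]
          ring
      _ ≤ ENNReal.ofReal (10 ^ m) * ∑' a : u, ν (p ⁻¹' closedBall (p a) (r a)) := by
          gcongr with a
          exact hr a (huD a.2)
      _ = ENNReal.ofReal (10 ^ m) * ν (⋃ a ∈ u, p ⁻¹' closedBall (p a) (r a)) := by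
          rw [measure_biUnion hucount (fun a ha b hb hab => (hdisj ha hb hab).preimage p)
            (fun a _ => hp measurableSet_closedBall)]
      _ ≤ _ := by gcongr; exact subset_univ _
  have hfin : ENNReal.ofReal (10 ^ m) * ν univ ≠ ∞ :=
    ENNReal.mul_ne_top ENNReal.ofReal_ne_top (measure_ne_top _ _)
  by_contra h0
  obtain ⟨q, hq⟩ := ENNReal.exists_nat_mul_gt h0 hfin
  exact absurd (key q) (not_le.2 hq)

/-- Almost every fibre of a Lipschitz map on a set of finite measure is finite. -/
theorem LipschitzWith.volume_infinite_fibre_eq_zero {X : Type*} [MetricSpace X]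
    [SecondCountableTopology X] [Nonempty X] [MeasurableSpace X] [BorelSpace X] {m : ℕ}
    {p : X → Fin m → ℝ} {K : ℝ≥0} (hp : LipschitzWith K p) {A : Set X} (hA : MeasurableSet A)
    (hfin : μH[(m : ℝ)] A ≠ ∞) :
    volume {y | (A ∩ p ⁻¹' {y}).Infinite} = 0 := by
  set W : ℕ → ℕ → Set X := fun k i =>
    disjointed (fun i => ball (TopologicalSpace.denseSeq X i) (1 / ((k : ℝ) + 1))) i ∩ A with hW
  have hWmeas : ∀ k i, MeasurableSet (W k i) := fun k i =>
    (MeasurableSet.disjointed (fun _ => measurableSet_ball) i).inter hA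
  have hWdisj : ∀ k, Pairwise (Function.onFun Disjoint (W k)) := fun k i j hij =>
    (disjoint_disjointed _ hij).mono inter_subset_left inter_subset_left
  have hWdiam : ∀ k i, ∀ x ∈ W k i, ∀ y ∈ W k i, dist x y < 2 / ((k : ℝ) + 1) := by
    intro k i x hx y hy
    have hsub := disjointed_subset
      (fun i => ball (TopologicalSpace.denseSeq X i) (1 / ((k : ℝ) + 1))) i
    have h1 := mem_ball.1 (hsub hx.1)
    have h2 := mem_ball.1 (hsub hy.1)
    have h3 := dist_triangle_right x y (TopologicalSpace.denseSeq X i)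
    have h4 : 2 / ((k : ℝ) + 1) = 1 / ((k : ℝ) + 1) + 1 / ((k : ℝ) + 1) := by ring
    linarith
  have hWcov : ∀ k, ∀ x ∈ A, ∃ i, x ∈ W k i := by
    intro k x hx
    have h1 : x ∈ ⋃ i, ball (TopologicalSpace.denseSeq X i) (1 / ((k : ℝ) + 1)) := by
      obtain ⟨i, hy⟩ := (TopologicalSpace.denseRange_denseSeq X).exists_dist_lt x
        (show 0 < 1 / ((k : ℝ) + 1) by positivity)
      exact mem_iUnion.2 ⟨i, hy⟩
    rw [← iUnion_disjointed] at h1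
    obtain ⟨i, hi⟩ := mem_iUnion.1 h1
    exact ⟨i, hi, hx⟩
  set H : ℕ → ℕ → Set (Fin m → ℝ) := fun k i => toMeasurable volume (p '' W k i) with hH
  set N : ℕ → (Fin m → ℝ) → ℝ≥0∞ := fun k y => ∑' i, (H k i).indicator 1 y with hN
  have hNmeas : ∀ k, Measurable (N k) := fun k =>
    Measurable.tsum fun i =>
      measurable_one.indicator (measurableSet_toMeasurable _ _)
  have hNint : ∀ k, ∫⁻ y, N k y ≤ (K : ℝ≥0∞) ^ (m : ℝ) * μH[(m : ℝ)] A := by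
    intro k
    rw [lintegral_tsum fun i =>
      (measurable_one.indicator (measurableSet_toMeasurable _ _)).aemeasurable]
    calc _ = ∑' i, volume (p '' W k i) := by
          refine tsum_congr fun i => ?_
          rw [lintegral_indicator_one (measurableSet_toMeasurable _ _), measure_toMeasurable]
      _ ≤ ∑' i, (K : ℝ≥0∞) ^ (m : ℝ) * μH[(m : ℝ)] (W k i) := by
          refine ENNReal.tsum_le_tsum fun i => ?_
          rw [← hausdorffMeasure_fin_real]
          exact hp.hausdorffMeasure_image_le (by positivity) _
      _ = (K : ℝ≥0∞) ^ (m : ℝ) * μH[(m : ℝ)] (⋃ i, W k i) := by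
          rw [ENNReal.tsum_mul_left, measure_iUnion (hWdisj k) (hWmeas k)]
      _ ≤ _ := by
          gcongr
          exact iUnion_subset fun i => inter_subset_right
  have hlim : ∫⁻ y, Filter.liminf (fun k => N k y) Filter.atTop ≠ ∞ := by
    refine ((lintegral_liminf_le hNmeas).trans_lt (lt_of_le_of_lt
      (Filter.liminf_le_of_frequently_le' (Filter.Frequently.of_forall hNint)) ?_)).ne
    exact ENNReal.mul_lt_top (ENNReal.rpow_lt_top_of_nonneg (by positivity) ENNReal.coe_ne_top)
      hfin.lt_top
  have hae := ae_lt_top (Measurable.liminf hNmeas) hlim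
  refine measure_mono_null (fun y hy => ?_) hae
  change ¬ (Filter.liminf (fun k => N k y) Filter.atTop < ∞)
  rw [not_lt, top_le_iff]
  refine ENNReal.eq_top_of_forall_nnreal_le fun c => ?_
  obtain ⟨M, hM⟩ := exists_nat_gt c
  refine le_trans (b := (M : ℝ≥0∞)) (by exact_mod_cast hM.le) ?_
  refine Filter.le_liminf_of_le (by isBoundedDefault) ?_
  obtain ⟨t, ht, htM⟩ := Set.Infinite.exists_subset_card_eq hy M
  have hsep : ∀ᶠ k : ℕ in Filter.atTop, ∀ x ∈ t, ∀ z ∈ t, x ≠ z → 2 / ((k : ℝ) + 1) < dist x z := by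
    simp only [Filter.eventually_all_finset]
    intro x _ z _
    by_cases hxz : x = z
    · simp [hxz]
    have h1 : Filter.Tendsto (fun k : ℕ => 2 / ((k : ℝ) + 1)) Filter.atTop (𝓝 0) := by
      have := (tendsto_one_div_add_atTop_nhds_zero_nat (𝕜 := ℝ)).const_mul 2
      simpa [div_eq_mul_inv] using this
    filter_upwards [h1.eventually (gt_mem_nhds (dist_pos.2 hxz))] with k hk _ using hk
  filter_upwards [hsep] with k hk
  choose! ix hix using hWcov k
  have hinj : InjOn ix t := by
    intro x hx z hz hxz
    by_contra hne
    have h1 := hk x hx z hz hne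
    have h2 := hix z (ht hz).1
    rw [← hxz] at h2
    exact absurd (hWdiam k _ x (hix x (ht hx).1) z h2) (not_lt.2 h1.le)
  classical
  calc (M : ℝ≥0∞) = ∑ i ∈ t.image ix, 1 := by
        rw [Finset.sum_const, Finset.card_image_of_injOn hinj, htM]; simp
    _ = ∑ i ∈ t.image ix, (H k i).indicator 1 y := by
        refine Finset.sum_congr rfl fun i hi => ?_
        obtain ⟨x, hx, rfl⟩ := Finset.mem_image.1 hi
        rw [indicator_of_mem]
        · rfl
        · exact subset_toMeasurable _ _ ⟨x, hix x (ht hx).1, (ht hx).2⟩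
    _ ≤ N k y := ENNReal.sum_le_tsum _

theorem eventually_volume_closedBall_diff_le {m : ℕ} {F : Set (Fin m → ℝ)} (hF : IsClosed F)
    {u : Fin m → ℝ}
    (hu : Filter.Tendsto (fun r => volume (F ∩ closedBall u r) / volume (closedBall u r))
      (𝓝[>] 0) (𝓝 1)) {e : ℝ} (he : 0 < e) :
    ∀ᶠ r in 𝓝[>] (0 : ℝ), volume (closedBall u r \ F) ≤ ENNReal.ofReal (e * (2 * r) ^ m) := by
  have h1 : (1 : ℝ≥0∞) - ENNReal.ofReal e < 1 :=
    ENNReal.sub_lt_self ENNReal.one_ne_top one_ne_zero (by simpa using he)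
  filter_upwards [hu.eventually (lt_mem_nhds h1), self_mem_nhdsWithin] with r hr hr0
  have hr0 : 0 < r := hr0
  set V := volume (closedBall u r) with hV
  have hVval : V = ENNReal.ofReal ((2 * r) ^ m) := by
    rw [hV, Real.volume_pi_closedBall _ hr0.le, Fintype.card_fin]
  have hV0 : V ≠ 0 := by
    rw [hVval]
    simp only [ne_eq, ENNReal.ofReal_eq_zero, not_le]
    positivity
  have hVt : V ≠ ∞ := by rw [hVval]; exact ENNReal.ofReal_ne_top
  have hsum : volume (closedBall u r ∩ F) + volume (closedBall u r \ F) = V :=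
    measure_inter_add_sdiff _ hF.measurableSet
  have hle : V ≤ volume (closedBall u r ∩ F) + ENNReal.ofReal e * V := by
    have h2 : (1 - ENNReal.ofReal e) * V ≤ volume (closedBall u r ∩ F) := by
      rw [inter_comm, ← ENNReal.le_div_iff_mul_le (Or.inl hV0) (Or.inl hVt)]
      exact hr.le
    calc V = 1 * V := (one_mul _).symm
      _ ≤ ((1 - ENNReal.ofReal e) + ENNReal.ofReal e) * V := by
        gcongr
        exact le_tsub_add
      _ = (1 - ENNReal.ofReal e) * V + ENNReal.ofReal e * V := add_mul _ _ _
      _ ≤ _ := by gcongr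
  rw [ENNReal.ofReal_mul he.le, ← hVval]
  have hfin : volume (closedBall u r ∩ F) ≠ ∞ :=
    ((measure_mono inter_subset_left).trans_lt hVt.lt_top).ne
  rw [← hsum] at hle
  exact (ENNReal.add_le_add_iff_left hfin).1 (by rwa [hsum] at hle ⊢)

/-- At a density point `u` of a closed set `F` which is null for all `ν i`, a bound
`ν i (B(z, r)) ≤ c r ^ m` on `F` improves to `o(r ^ m)`. -/
theorem eventually_measure_closedBall_le_of_density {m : ℕ} {F : Set (Fin m → ℝ)}
    (hF : IsClosed F) {ν : ℕ → Measure (Fin m → ℝ)} (hν : ∀ i, ν i F = 0) {c : ℝ} (hc : 0 ≤ c)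
    (hbound : ∀ z ∈ F, ∀ k ≥ 1, ∀ i, ν i (closedBall z ((1 / 2) ^ k)) ≤
      ENNReal.ofReal (c * ((1 / 2) ^ k) ^ m))
    {u : Fin m → ℝ} (huF : u ∈ F)
    (hu : Filter.Tendsto (fun r => volume (F ∩ closedBall u r) / volume (closedBall u r))
      (𝓝[>] 0) (𝓝 1)) {e : ℝ} (he : 0 < e) :
    ∃ k₀ : ℕ, ∀ k ≥ k₀, ∀ i, ν i (closedBall u ((1 / 2) ^ k)) ≤
      ENNReal.ofReal (e * ((1 / 2) ^ k) ^ m) := by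
  set e' : ℝ := e / (c * 64 ^ m + 1) with he'
  have he'0 : 0 < e' := by positivity
  have hcle : c * 64 ^ m * e' ≤ e := by
    rw [he', mul_div_assoc', div_le_iff₀ (by positivity)]
    nlinarith
  have hlim : Filter.Tendsto (fun k : ℕ => 2 * (1 / 2 : ℝ) ^ k) Filter.atTop (𝓝[>] 0) := by
    refine tendsto_nhdsWithin_iff.2 ⟨?_, Filter.Eventually.of_forall fun k => ?_⟩
    · simpa using (tendsto_pow_atTop_nhds_zero_of_lt_one (by norm_num : (0 : ℝ) ≤ 1 / 2)
        (by norm_num)).const_mul 2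
    · exact mem_Ioi.2 (by positivity)
  obtain ⟨k₁, hk₁⟩ := Filter.eventually_atTop.1
    (hlim.eventually (eventually_volume_closedBall_diff_le hF hu he'0))
  refine ⟨max k₁ 3, fun k hk i => ?_⟩
  have hvol := hk₁ k ((le_max_left _ _).trans hk)
  set s : ℝ := (1 / 2) ^ k with hs
  have hs0 : 0 < s := by positivity
  have hs8 : s ≤ 1 / 8 := by
    calc s ≤ (1 / 2) ^ 3 := pow_le_pow_of_le_one (by norm_num) (by norm_num)
          ((le_max_right _ _).trans hk)
      _ = 1 / 8 := by norm_num
  have hFne : F.Nonempty := ⟨u, huF⟩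
  have hd0 : ∀ y ∈ closedBall u s \ F, 0 < infDist y F := fun y hy =>
    (hF.notMem_iff_infDist_pos hFne).1 hy.2
  have hds : ∀ y ∈ closedBall u s \ F, infDist y F ≤ s := fun y hy =>
    (infDist_le_dist_of_mem huF).trans hy.1
  obtain ⟨t, ht, hdisj, hcov⟩ :=
    Vitali.exists_disjoint_subfamily_covering_enlargement_closedBall (closedBall u s \ F) id
      (fun y => infDist y F / 4) (s / 4) (fun y hy => by have := hds y hy; linarith) 5
      (by norm_num)
  simp only [id] at hdisj hcov
  have htcount : t.Countable := hdisj.countable_of_nonempty_interior fun y hy =>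
    ⟨y, ball_subset_interior_closedBall (mem_ball_self (by have := hd0 y (ht hy); positivity))⟩
  have hpiece : ∀ y ∈ t, ν i (closedBall y (5 * (infDist y F / 4))) ≤
      ENNReal.ofReal (c * 16 ^ m) * volume (closedBall y (infDist y F / 4)) := by
    intro y hy
    have h0 := hd0 y (ht hy)
    have h1 := hds y (ht hy)
    set d := infDist y F with hd
    obtain ⟨z, hz, hyz⟩ := (infDist_lt_iff hFne).1 (show infDist y F < 2 * d by linarith)
    obtain ⟨k', hk1, hk2⟩ := exists_nat_pow_near_of_lt_one (show 0 < 4 * d by linarith)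
      (show 4 * d ≤ 1 by linarith) (by norm_num : (0 : ℝ) < 1 / 2) (by norm_num)
    have hk' : 1 ≤ k' := by
      have h2 : (1 / 2 : ℝ) ^ (k' + 1) < (1 / 2) ^ 1 := by linarith
      have := (pow_lt_pow_iff_right_of_lt_one₀ (by norm_num : (0 : ℝ) < 1 / 2)
        (by norm_num)).1 h2
      omega
    have hsub : closedBall y (5 * (d / 4)) ⊆ closedBall z ((1 / 2) ^ k') :=
      closedBall_subset_closedBall' (by linarith)
    refine (measure_mono hsub).trans ((hbound z hz k' hk' i).trans ?_)
    rw [Real.volume_pi_closedBall _ (by positivity), Fintype.card_fin,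
      ← ENNReal.ofReal_mul (by positivity)]
    refine ENNReal.ofReal_le_ofReal ?_
    rw [mul_assoc, ← mul_pow]
    rw [pow_succ] at hk1
    gcongr
    linarith
  calc ν i (closedBall u s) ≤ ν i (F ∪ ⋃ y ∈ t, closedBall y (5 * (infDist y F / 4))) := by
        refine measure_mono fun y hy => ?_
        by_cases hyF : y ∈ F
        · exact Or.inl hyF
        · obtain ⟨b, hb, hsub⟩ := hcov y ⟨hy, hyF⟩
          have := hd0 y ⟨hy, hyF⟩
          exact Or.inr (mem_iUnion₂.2 ⟨b, hb, hsub (mem_closedBall_self (by positivity))⟩)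
    _ ≤ 0 + ∑' y : t, ν i (closedBall (y : Fin m → ℝ) (5 * (infDist (y : Fin m → ℝ) F / 4))) := by
        refine (measure_union_le _ _).trans ?_
        rw [hν i]
        gcongr
        exact measure_biUnion_le _ htcount _
    _ ≤ ∑' y : t, ENNReal.ofReal (c * 16 ^ m) *
          volume (closedBall (y : Fin m → ℝ) (infDist (y : Fin m → ℝ) F / 4)) := by
        rw [zero_add]
        exact ENNReal.tsum_le_tsum fun y => hpiece y y.2
    _ = ENNReal.ofReal (c * 16 ^ m) * volume (⋃ y ∈ t, closedBall y (infDist y F / 4)) := by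
        rw [ENNReal.tsum_mul_left,
          measure_biUnion htcount hdisj (fun _ _ => measurableSet_closedBall)]
    _ ≤ ENNReal.ofReal (c * 16 ^ m) * volume (closedBall u (2 * s) \ F) := by
        gcongr
        refine iUnion₂_subset fun y hy w hw => ⟨?_, fun hwF => ?_⟩
        · have h1 := mem_closedBall.1 hw
          have h2 := mem_closedBall.1 (ht hy).1
          have h3 := hds y (ht hy)
          rw [mem_closedBall]
          linarith [dist_triangle w y u]
        · have h1 := mem_closedBall'.1 hw
          have h2 := infDist_le_dist_of_mem (x := y) hwF
          linarith [hd0 y (ht hy)]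
    _ ≤ ENNReal.ofReal (c * 16 ^ m) * ENNReal.ofReal (e' * (2 * (2 * s)) ^ m) := by gcongr
    _ ≤ ENNReal.ofReal (e * s ^ m) := by
        rw [← ENNReal.ofReal_mul (by positivity)]
        refine ENNReal.ofReal_le_ofReal ?_
        calc c * 16 ^ m * (e' * (2 * (2 * s)) ^ m) = c * 64 ^ m * e' * s ^ m := by
              rw [show (64 : ℝ) = 16 * 4 by norm_num, show 2 * (2 * s) = 4 * s by ring,
                mul_pow, mul_pow]
              ring
          _ ≤ e * s ^ m := by gcongr

/-- Almost everywhere on a common null set `H` of the measures `ν i`, the upper `m`-density of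
`⨆ i, ν i` is either infinite or zero. -/
theorem ae_upper_density_eq_zero_of_bounded {m : ℕ} {H : Set (Fin m → ℝ)}
    (hH : MeasurableSet H) {ν : ℕ → Measure (Fin m → ℝ)} (hν : ∀ i, ν i H = 0) :
    ∀ᵐ u : Fin m → ℝ, u ∈ H →
      (∃ q : ℕ, ∀ k i, ν i (closedBall u ((1 / 2) ^ k)) ≤
        ENNReal.ofReal (q * ((1 / 2) ^ k) ^ m)) →
      ∀ e : ℝ, 0 < e → ∃ k₀ : ℕ, ∀ k ≥ k₀, ∀ i, ν i (closedBall u ((1 / 2) ^ k)) ≤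
        ENNReal.ofReal (e * ((1 / 2) ^ k) ^ m) := by
  set good : Set (Fin m → ℝ) := {u | ∀ e : ℝ, 0 < e → ∃ k₀ : ℕ, ∀ k ≥ k₀, ∀ i,
    ν i (closedBall u ((1 / 2) ^ k)) ≤ ENNReal.ofReal (e * ((1 / 2) ^ k) ^ m)} with hgood
  set Z : ℕ → Set (Fin m → ℝ) := fun q => {u ∈ H | ∀ k i,
    ν i (closedBall u ((1 / 2) ^ k)) ≤ ENNReal.ofReal (q * ((1 / 2) ^ k) ^ m)} with hZ
  suffices h : ∀ q N : ℕ, ∀ᵐ u : Fin m → ℝ,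
      u ∈ closure (Z q) ∩ H ∩ closedBall 0 N → u ∈ good by
    have h' : ∀ᵐ u : Fin m → ℝ, ∀ q N : ℕ,
      u ∈ closure (Z q) ∩ H ∩ closedBall 0 N → u ∈ good := by
      rw [ae_all_iff]; intro q; rw [ae_all_iff]; exact h q
    filter_upwards [h'] with u hu huH ⟨q, hq⟩
    obtain ⟨N, hN⟩ := exists_nat_ge (dist u 0)
    exact hu q N ⟨⟨subset_closure ⟨huH, hq⟩, huH⟩, hN⟩
  intro q N
  set W := closure (Z q) ∩ H ∩ closedBall 0 N with hW
  have hWmeas : MeasurableSet W :=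
    (isClosed_closure.measurableSet.inter hH).inter measurableSet_closedBall
  have hWfin : volume W ≠ ∞ :=
    ((measure_mono inter_subset_right).trans_lt measure_closedBall_lt_top).ne
  have hWbound : ∀ z ∈ W, ∀ k ≥ 1, ∀ i, ν i (closedBall z ((1 / 2) ^ k)) ≤
      ENNReal.ofReal ((q * 2 ^ m) * ((1 / 2) ^ k) ^ m) := by
    intro w hw k hk i
    obtain ⟨k, rfl⟩ := Nat.exists_eq_add_of_le' hk
    obtain ⟨z, hz, hwz⟩ := Metric.mem_closure_iff.1 hw.1.1 ((1 / 2) ^ (k + 1)) (by positivity)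
    have hsub : closedBall w ((1 / 2) ^ (k + 1)) ⊆ closedBall z ((1 / 2) ^ k) :=
      closedBall_subset_closedBall' (by
        have : (1 / 2 : ℝ) ^ k = (1 / 2) ^ (k + 1) + (1 / 2) ^ (k + 1) := by ring
        linarith)
    refine (measure_mono hsub).trans ((hz.2 k i).trans (le_of_eq ?_))
    congr 1
    rw [mul_assoc, ← mul_pow]
    congr 2
    ring
  have hF : ∀ j : ℕ, ∃ F ⊆ W, IsClosed F ∧ volume (W \ F) < ENNReal.ofReal (1 / ((j : ℝ) + 1)) :=
    fun j => hWmeas.exists_isClosed_sdiff_lt hWfin (by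
      simp only [ne_eq, ENNReal.ofReal_eq_zero, not_le]; positivity)
  choose F hFW hFc hFvol using hF
  have hnull : volume (W \ ⋃ j, F j) = 0 := by
    have hlim : Filter.Tendsto (fun j : ℕ => ENNReal.ofReal (1 / ((j : ℝ) + 1))) Filter.atTop
        (𝓝 0) := by
      have := ENNReal.tendsto_ofReal (tendsto_one_div_add_atTop_nhds_zero_nat (𝕜 := ℝ))
      simpa using this
    refine le_antisymm (ge_of_tendsto' hlim fun j => ?_) zero_le
    exact (measure_mono (sdiff_subset_sdiff_right (subset_iUnion F j))).trans (hFvol j).le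
  have hdens : ∀ᵐ u : Fin m → ℝ, ∀ j, u ∈ F j → u ∈ good := by
    rw [ae_all_iff]
    intro j
    have := (ae_restrict_iff' (hFc j).measurableSet).1
      (Besicovitch.ae_tendsto_measure_inter_div volume (F j))
    filter_upwards [this] with u hu huF e he
    exact eventually_measure_closedBall_le_of_density (hFc j)
      (fun i => measure_mono_null (fun x hx => (hFW j hx).1.2) (hν i)) (by positivity)
      (fun z hz => hWbound z (hFW j hz)) huF (hu huF) he
  filter_upwards [hdens, measure_eq_zero_iff_ae_notMem.1 hnull] with u hu hu' huW
  have : u ∈ ⋃ j, F j := by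
    by_contra hn
    exact hu' ⟨huW, hn⟩
  obtain ⟨j, hj⟩ := mem_iUnion.1 this
  exact hu j hj

/-- A measurable set is null if all its slices along translates of a measurable family of
vectors are null. -/
theorem measure_eq_zero_of_forall_translate {P U : Type*} [AddGroup P] [MeasurableSpace P]
    [MeasurableAdd₂ P] [MeasurableSpace U] (μ : Measure P) [SFinite μ] [μ.IsAddRightInvariant]
    (ν : Measure U) [SFinite ν] [NeZero ν] {ι : U → P} (hι : Measurable ι) {N : Set P}
    (hN : MeasurableSet N) (h : ∀ b, ν {u | b + ι u ∈ N} = 0) : μ N = 0 := by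
  have hmeas : MeasurableSet {x : P × U | x.1 + ι x.2 ∉ N} :=
    (measurable_fst.add (hι.comp measurable_snd)) hN.compl
  have h1 : ∀ᵐ b ∂μ, ∀ᵐ u ∂ν, b + ι u ∉ N := by
    refine Filter.Eventually.of_forall fun b => ?_
    rw [ae_iff]
    simpa using h b
  obtain ⟨u, hu⟩ := ((Measure.ae_ae_comm hmeas).1 h1).exists
  rw [ae_iff] at hu
  simp only [not_not] at hu
  rwa [show {b | b + ι u ∈ N} = (fun b => b + ι u) ⁻¹' N from rfl,
    measure_preimage_add_right] at hu

/-- The linear map `ℝⁿ → ℝ^m` with matrix `B`. -/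
def rowMap {n m : ℕ} (B : Fin m → Fin n → ℝ) (x : EuclideanSpace ℝ (Fin n)) : Fin m → ℝ :=
  fun i => ∑ j, B i j * x j

theorem continuous_rowMap_uncurry {n m : ℕ} : Continuous fun z :
    (Fin m → Fin n → ℝ) × EuclideanSpace ℝ (Fin n) => rowMap z.1 z.2 := by
  unfold rowMap
  fun_prop

theorem continuous_rowMap {n m : ℕ} (B : Fin m → Fin n → ℝ) : Continuous (rowMap B) := by
  unfold rowMap
  fun_prop

theorem rowMap_sub {n m : ℕ} (B : Fin m → Fin n → ℝ) (x y : EuclideanSpace ℝ (Fin n)) :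
    rowMap B (x - y) = rowMap B x - rowMap B y := by
  ext i
  simp [rowMap, mul_sub]

theorem exists_lipschitzWith_rowMap {n m : ℕ} (B : Fin m → Fin n → ℝ) :
    ∃ K : ℝ≥0, LipschitzWith K (rowMap B) := by
  let f : EuclideanSpace ℝ (Fin n) →ₗ[ℝ] (Fin m → ℝ) :=
    { toFun := rowMap B
      map_add' := fun x y => by ext i; simp [rowMap, mul_add, Finset.sum_add_distrib]
      map_smul' := fun c x => by ext i; simp [rowMap, Finset.mul_sum, mul_left_comm] }
  exact ⟨_, (LinearMap.toContinuousLinearMap f).lipschitz⟩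

/-- The matrix with column `j` equal to `u` and other columns zero. -/
def columnMatrix {n m : ℕ} (j : Fin n) (u : Fin m → ℝ) : Fin m → Fin n → ℝ :=
  fun i j' => if j' = j then u i else 0

theorem measurable_columnMatrix {n m : ℕ} (j : Fin n) :
    Measurable (columnMatrix (m := m) j) := by
  unfold columnMatrix
  refine measurable_pi_lambda _ fun i => measurable_pi_lambda _ fun j' => ?_
  split_ifs <;> fun_prop

theorem rowMap_add_columnMatrix {n m : ℕ} (B : Fin m → Fin n → ℝ) (j : Fin n)
    (u : Fin m → ℝ) (x : EuclideanSpace ℝ (Fin n)) :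
    rowMap (B + columnMatrix j u) x = rowMap B x + x j • u := by
  ext i
  simp [rowMap, columnMatrix, add_mul, Finset.sum_add_distrib, mul_comm]

/-- The points near `a` that are nearly in the same fibre of `rowMap B` as `a`, where nearness
is measured relative to the displacement in the `j`-th coordinate. -/
def fibreCone {n m : ℕ} (j : Fin n) (i k : ℕ) (a : EuclideanSpace ℝ (Fin n))
    (B : Fin m → Fin n → ℝ) : Set (EuclideanSpace ℝ (Fin n)) :=
  {x | dist x a ≤ (1 / 2) ^ i ∧ x j ≠ a j ∧
    dist (rowMap B x) (rowMap B a) ≤ (1 / 2) ^ k * |x j - a j|}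

theorem measurable_measure_fibreCone {n m : ℕ} (μ : Measure (EuclideanSpace ℝ (Fin n)))
    [SFinite μ] (j : Fin n) (i k : ℕ) :
    Measurable fun z : EuclideanSpace ℝ (Fin n) × (Fin m → Fin n → ℝ) =>
      μ (fibreCone j i k z.1 z.2) := by
  let s : Set ((EuclideanSpace ℝ (Fin n) × (Fin m → Fin n → ℝ)) × EuclideanSpace ℝ (Fin n)) :=
    {w | w.2 ∈ fibreCone j i k w.1.1 w.1.2}
  have hs : MeasurableSet s := by
    have c1 : Continuous fun w : (EuclideanSpace ℝ (Fin n) × (Fin m → Fin n → ℝ)) ×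
        EuclideanSpace ℝ (Fin n) => rowMap w.1.2 w.2 :=
      continuous_rowMap_uncurry.comp
        ((continuous_snd.comp continuous_fst).prodMk continuous_snd)
    have c2 : Continuous fun w : (EuclideanSpace ℝ (Fin n) × (Fin m → Fin n → ℝ)) ×
        EuclideanSpace ℝ (Fin n) => rowMap w.1.2 w.1.1 :=
      continuous_rowMap_uncurry.comp
        ((continuous_snd.comp continuous_fst).prodMk (continuous_fst.comp continuous_fst))
    have c3 : Continuous fun w : (EuclideanSpace ℝ (Fin n) × (Fin m → Fin n → ℝ)) ×
        EuclideanSpace ℝ (Fin n) => dist w.2 w.1.1 := by fun_prop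
    refine MeasurableSet.inter ?_ (MeasurableSet.inter ?_ ?_)
    · exact (isClosed_le c3 continuous_const).measurableSet
    · exact (isOpen_ne_fun (by fun_prop) (by fun_prop)).measurableSet
    · exact (isClosed_le (c1.dist c2) (by fun_prop)).measurableSet
  exact measurable_measure_prodMk_left hs

/-- The point `a` is a close neighbour of another point of `A` in the same fibre. -/
def FibreHit {n m : ℕ} (A : Set (EuclideanSpace ℝ (Fin n))) (l : ℕ)
    (a : EuclideanSpace ℝ (Fin n)) (B : Fin m → Fin n → ℝ) : Prop :=
  ∃ x ∈ A, 0 < dist x a ∧ dist x a ≤ (1 / 2) ^ l ∧ rowMap B x = rowMap B a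

theorem measurableSet_fibreHit {n m : ℕ} {A : Set (EuclideanSpace ℝ (Fin n))}
    (hA : IsCompact A) (l : ℕ) :
    MeasurableSet {z : EuclideanSpace ℝ (Fin n) × (Fin m → Fin n → ℝ) |
      FibreHit A l z.1 z.2} := by
  have := isCompact_iff_compactSpace.1 hA
  let F : ℕ → Set (A × (EuclideanSpace ℝ (Fin n) × (Fin m → Fin n → ℝ))) := fun N =>
    {w | 1 / ((N : ℝ) + 1) ≤ dist (w.1 : EuclideanSpace ℝ (Fin n)) w.2.1 ∧
      dist (w.1 : EuclideanSpace ℝ (Fin n)) w.2.1 ≤ (1 / 2) ^ l ∧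
      rowMap w.2.2 w.1 = rowMap w.2.2 w.2.1}
  have hF : ∀ N, IsClosed (F N) := by
    intro N
    have c1 : Continuous fun w : A × (EuclideanSpace ℝ (Fin n) × (Fin m → Fin n → ℝ)) =>
        rowMap w.2.2 (w.1 : EuclideanSpace ℝ (Fin n)) :=
      continuous_rowMap_uncurry.comp ((continuous_snd.comp continuous_snd).prodMk
        (continuous_subtype_val.comp continuous_fst))
    have c2 : Continuous fun w : A × (EuclideanSpace ℝ (Fin n) × (Fin m → Fin n → ℝ)) =>
        rowMap w.2.2 w.2.1 :=
      continuous_rowMap_uncurry.comp ((continuous_snd.comp continuous_snd).prodMk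
        (continuous_fst.comp continuous_snd))
    have c3 : Continuous fun w : A × (EuclideanSpace ℝ (Fin n) × (Fin m → Fin n → ℝ)) =>
        dist (w.1 : EuclideanSpace ℝ (Fin n)) w.2.1 := by fun_prop
    refine IsClosed.inter ?_ (IsClosed.inter ?_ ?_)
    · exact isClosed_le continuous_const c3
    · exact isClosed_le c3 continuous_const
    · exact isClosed_eq c1 c2
  have heq : {z : EuclideanSpace ℝ (Fin n) × (Fin m → Fin n → ℝ) | FibreHit A l z.1 z.2} =
      ⋃ N, Prod.snd '' F N := by
    ext z
    simp only [mem_ofPred_eq, mem_iUnion, mem_image, FibreHit]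
    constructor
    · rintro ⟨x, hx, h0, h1, h2⟩
      obtain ⟨N, hN⟩ := exists_nat_one_div_lt h0
      exact ⟨N, (⟨x, hx⟩, z), ⟨hN.le, h1, h2⟩, rfl⟩
    · rintro ⟨N, w, ⟨h0, h1, h2⟩, rfl⟩
      exact ⟨w.1, w.1.2, lt_of_lt_of_le (by positivity) h0, h1, h2⟩
  rw [heq]
  exact MeasurableSet.iUnion fun N =>
    (isClosedMap_snd_of_compactSpace _ (hF N)).measurableSet

/-- The exceptional pairs: no close neighbour in the fibre, bounded cone densities, and yet
cone densities not tending to zero. -/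
def exceptionalPairs {n m : ℕ} (A : Set (EuclideanSpace ℝ (Fin n))) (l : ℕ) (j : Fin n) :
    Set (EuclideanSpace ℝ (Fin n) × (Fin m → Fin n → ℝ)) :=
  {z | ¬ FibreHit A l z.1 z.2 ∧
    (∃ q : ℕ, ∀ k i, (μH[(m : ℝ)].restrict A) (fibreCone j (i + l) k z.1 z.2) ≤
      ENNReal.ofReal (q * ((1 / 2) ^ (i + l + k)) ^ m)) ∧
    ¬ ∀ N : ℕ, ∃ k₀, ∀ k ≥ k₀, ∀ i,
      (μH[(m : ℝ)].restrict A) (fibreCone j (i + l) k z.1 z.2) ≤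
        ENNReal.ofReal (1 / (N + 1) * ((1 / 2) ^ (i + l + k)) ^ m)}

theorem measurableSet_exceptionalPairs {n m : ℕ} {A : Set (EuclideanSpace ℝ (Fin n))}
    (hA : IsCompact A) (hfin : μH[(m : ℝ)] A ≠ ∞) (l : ℕ) (j : Fin n) :
    MeasurableSet (exceptionalPairs (m := m) A l j) := by
  have : IsFiniteMeasure (μH[(m : ℝ)].restrict A) :=
    isFiniteMeasure_restrict.2 hfin
  have hle : ∀ (i k : ℕ) (c : ℝ≥0∞),
      MeasurableSet {z : EuclideanSpace ℝ (Fin n) × (Fin m → Fin n → ℝ) |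
        (μH[(m : ℝ)].restrict A) (fibreCone j i k z.1 z.2) ≤ c} := fun i k c =>
    measurableSet_le (measurable_measure_fibreCone _ j i k) measurable_const
  have h1 : MeasurableSet {z : EuclideanSpace ℝ (Fin n) × (Fin m → Fin n → ℝ) |
      ∃ q : ℕ, ∀ k i, (μH[(m : ℝ)].restrict A) (fibreCone j (i + l) k z.1 z.2) ≤
        ENNReal.ofReal (q * ((1 / 2) ^ (i + l + k)) ^ m)} := by
    simp only [ofPred_exists, ofPred_forall]
    exact .iUnion fun q => .iInter fun k => .iInter fun i => hle _ _ _
  have h2 : MeasurableSet {z : EuclideanSpace ℝ (Fin n) × (Fin m → Fin n → ℝ) |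
      ∀ N : ℕ, ∃ k₀, ∀ k ≥ k₀, ∀ i,
        (μH[(m : ℝ)].restrict A) (fibreCone j (i + l) k z.1 z.2) ≤
          ENNReal.ofReal (1 / (N + 1) * ((1 / 2) ^ (i + l + k)) ^ m)} := by
    simp only [ofPred_exists, ofPred_forall]
    exact .iInter fun N => .iUnion fun k₀ => .iInter fun k => .iInter fun _ =>
      .iInter fun i => hle _ _ _
  exact (measurableSet_fibreHit hA l).compl.inter (h1.inter h2.compl)

theorem volume_exceptional_columns {n m : ℕ} {A : Set (EuclideanSpace ℝ (Fin n))}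
    (hA : IsCompact A) (hfin : μH[(m : ℝ)] A ≠ ∞) (l : ℕ) (j : Fin n)
    (a : EuclideanSpace ℝ (Fin n)) (B : Fin m → Fin n → ℝ) :
    volume {u : Fin m → ℝ | (a, B + columnMatrix j u) ∈ exceptionalPairs A l j} = 0 := by
  have : IsFiniteMeasure (μH[(m : ℝ)].restrict A) :=
    isFiniteMeasure_restrict.2 hfin
  set slope : EuclideanSpace ℝ (Fin n) → Fin m → ℝ := fun x =>
    -((x j - a j)⁻¹ • rowMap B (x - a)) with hslope
  have hslope_meas : Measurable slope := by
    have h1 : Measurable fun x : EuclideanSpace ℝ (Fin n) => rowMap B (x - a) :=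
      ((continuous_rowMap B).comp (continuous_id.sub continuous_const)).measurable
    have h2 : Measurable fun x : EuclideanSpace ℝ (Fin n) => (x j - a j)⁻¹ := by fun_prop
    exact (h2.smul h1).neg
  have hdist : ∀ u x, dist (rowMap (B + columnMatrix j u) x)
      (rowMap (B + columnMatrix j u) a) = ‖rowMap B (x - a) + (x j - a j) • u‖ := by
    intro u x
    rw [rowMap_add_columnMatrix, rowMap_add_columnMatrix, dist_eq_norm, rowMap_sub, sub_smul]
    congr 1
    abel
  have hsl : ∀ u x, x j ≠ a j → dist (rowMap (B + columnMatrix j u) x)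
      (rowMap (B + columnMatrix j u) a) = dist (slope x) u * |x j - a j| := by
    intro u x hx
    have hx' : x j - a j ≠ 0 := sub_ne_zero.2 hx
    rw [hdist, dist_comm, dist_eq_norm, ← Real.norm_eq_abs, mul_comm, ← norm_smul, hslope]
    congr 1
    simp only [sub_neg_eq_add, smul_add, smul_smul]
    rw [mul_inv_cancel₀ hx', one_smul, add_comm]
  set T : ℕ → Set (EuclideanSpace ℝ (Fin n)) := fun i =>
    {x | dist x a ≤ (1 / 2) ^ i ∧ x j ≠ a j} with hT
  have hTmeas : ∀ i, MeasurableSet (T i) := fun i =>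
    (isClosed_le (f := fun x => dist x a) (by fun_prop) continuous_const).measurableSet.inter
      (isOpen_ne_fun (f := fun x : EuclideanSpace ℝ (Fin n) => x j)
        (by fun_prop) continuous_const).measurableSet
  have hcone : ∀ u i k, fibreCone j i k a (B + columnMatrix j u) =
      T i ∩ slope ⁻¹' closedBall u ((1 / 2) ^ k) := by
    intro u i k
    ext x
    simp only [fibreCone, mem_ofPred_eq, hT, mem_inter_iff, mem_preimage, mem_closedBall,
      and_assoc]
    refine and_congr_right fun _ => and_congr_right fun hx => ?_
    rw [hsl u x hx, mul_le_mul_iff_left₀ (abs_pos.2 (sub_ne_zero.2 hx))]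
  set H : Set (Fin m → ℝ) := (slope '' (A ∩ T l))ᶜ with hH
  have hHmeas : MeasurableSet H := by
    refine MeasurableSet.compl ?_
    have heq : A ∩ T l = ⋃ N : ℕ, (A ∩ {x | dist x a ≤ (1 / 2) ^ l ∧
        1 / ((N : ℝ) + 1) ≤ |x j - a j|}) := by
      ext x
      simp only [hT, mem_inter_iff, mem_ofPred_eq, mem_iUnion]
      constructor
      · rintro ⟨hx, h1, h2⟩
        obtain ⟨N, hN⟩ := exists_nat_one_div_lt (abs_pos.2 (sub_ne_zero.2 h2))
        exact ⟨N, hx, h1, hN.le⟩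
      · rintro ⟨N, hx, h1, h2⟩
        exact ⟨hx, h1, sub_ne_zero.1 (abs_pos.1 (lt_of_lt_of_le (by positivity) h2))⟩
    rw [heq, image_iUnion]
    refine MeasurableSet.iUnion fun N => ?_
    have hc : IsCompact (A ∩ {x | dist x a ≤ (1 / 2) ^ l ∧ 1 / ((N : ℝ) + 1) ≤ |x j - a j|}) :=
      hA.inter_right ((isClosed_le (f := fun x => dist x a) (by fun_prop)
        continuous_const).inter (isClosed_le
          (g := fun x : EuclideanSpace ℝ (Fin n) => |x j - a j|) continuous_const (by fun_prop)))
    refine (hc.image_of_continuousOn ?_).measurableSet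
    have h1 : Continuous fun x : EuclideanSpace ℝ (Fin n) => rowMap B (x - a) :=
      (continuous_rowMap B).comp (continuous_id.sub continuous_const)
    have h2 : Continuous fun x : EuclideanSpace ℝ (Fin n) => x j - a j := by fun_prop
    refine ContinuousOn.neg (ContinuousOn.smul (ContinuousOn.inv₀ h2.continuousOn ?_)
      h1.continuousOn)
    rintro x ⟨-, -, hx⟩
    exact abs_pos.1 (lt_of_lt_of_le (by positivity) hx)
  set c : ℕ → ℝ≥0∞ := fun i => (ENNReal.ofReal (((1 / 2) ^ i) ^ m))⁻¹ with hc
  set ν : ℕ → Measure (Fin m → ℝ) := fun i =>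
    c (i + l) • ((μH[(m : ℝ)].restrict A).restrict (T (i + l))).map slope with hν
  have hνapply : ∀ i, ∀ s, MeasurableSet s →
      ν i s = c (i + l) * (μH[(m : ℝ)].restrict A) (T (i + l) ∩ slope ⁻¹' s) := by
    intro i s hs
    rw [hν, Measure.smul_apply, Measure.map_apply hslope_meas hs,
      Measure.restrict_apply (hslope_meas hs), inter_comm, smul_eq_mul]
  have hνH : ∀ i, ν i H = 0 := by
    intro i
    rw [hνapply i H hHmeas, Measure.restrict_apply
      ((hTmeas _).inter (hslope_meas hHmeas))]
    have : T (i + l) ∩ slope ⁻¹' H ∩ A = ∅ := by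
      ext x
      simp only [mem_inter_iff, mem_preimage, mem_empty_iff_false, iff_false]
      rintro ⟨⟨hx1, hx2⟩, hx3⟩
      refine hx2 ⟨x, ⟨hx3, hx1.1.trans ?_, hx1.2⟩, rfl⟩
      exact pow_le_pow_of_le_one (by norm_num) (by norm_num) (by omega)
    rw [this, measure_empty, mul_zero]
  have hνle : ∀ u i k (e : ℝ), 0 ≤ e →
      (ν i (closedBall u ((1 / 2) ^ k)) ≤ ENNReal.ofReal (e * ((1 / 2) ^ k) ^ m) ↔
        (μH[(m : ℝ)].restrict A) (fibreCone j (i + l) k a (B + columnMatrix j u)) ≤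
          ENNReal.ofReal (e * ((1 / 2) ^ (i + l + k)) ^ m)) := by
    intro u i k e he
    rw [hνapply _ _ measurableSet_closedBall, ← hcone]
    have hpos : ENNReal.ofReal (((1 / 2 : ℝ) ^ (i + l)) ^ m) ≠ 0 := by
      rw [Ne, ENNReal.ofReal_eq_zero, not_le]; positivity
    have : ENNReal.ofReal (e * ((1 / 2) ^ (i + l + k)) ^ m) =
        ENNReal.ofReal (((1 / 2 : ℝ) ^ (i + l)) ^ m) *
          ENNReal.ofReal (e * ((1 / 2) ^ k) ^ m) := by
      rw [← ENNReal.ofReal_mul (by positivity)]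
      congr 1
      rw [pow_add _ (i + l) k, mul_pow]
      ring
    rw [this, hc]
    exact ENNReal.inv_mul_le_iff hpos ENNReal.ofReal_ne_top
  have hae := ae_upper_density_eq_zero_of_bounded hHmeas hνH
  rw [ae_iff] at hae
  refine measure_mono_null ?_ hae
  rintro u ⟨hhit, ⟨q, hq⟩, hN⟩ hcon
  refine hN fun N => ?_
  have huH : u ∈ H := by
    rintro ⟨x, ⟨hxA, hx1, hx2⟩, rfl⟩
    refine hhit ⟨x, hxA, dist_pos.2 fun h => hx2 (by rw [h]), hx1, ?_⟩
    have := hsl (slope x) x hx2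
    rw [dist_self, zero_mul] at this
    exact dist_eq_zero.1 this
  obtain ⟨k₀, hk₀⟩ := hcon huH ⟨q, fun k i => (hνle u i k q (by positivity)).2 (hq k i)⟩
    (1 / (N + 1)) (by positivity)
  exact ⟨k₀, fun k hk i => (hνle u i k _ (by positivity)).1 (hk₀ k hk i)⟩

theorem ae_ae_notMem_exceptionalPairs {n m : ℕ} {A : Set (EuclideanSpace ℝ (Fin n))}
    (hA : IsCompact A) (hfin : μH[(m : ℝ)] A ≠ ∞) :
    ∀ᵐ B : Fin m → Fin n → ℝ, ∀ᵐ a ∂(μH[(m : ℝ)].restrict A), ∀ l j,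
      (a, B) ∉ exceptionalPairs A l j := by
  have : IsFiniteMeasure (μH[(m : ℝ)].restrict A) :=
    isFiniteMeasure_restrict.2 hfin
  have h : ∀ l j, ∀ᵐ B : Fin m → Fin n → ℝ, ∀ᵐ a ∂(μH[(m : ℝ)].restrict A),
      (a, B) ∉ exceptionalPairs A l j := by
    intro l j
    have hm := measurableSet_exceptionalPairs hA hfin l j
    refine (Measure.ae_ae_comm (p := fun a B => (a, B) ∉ exceptionalPairs A l j) hm.compl).1
      (Filter.Eventually.of_forall fun a => ?_)
    rw [ae_iff]
    simp only [not_not]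
    exact measure_eq_zero_of_forall_translate volume volume (measurable_columnMatrix j)
      (measurable_prodMk_left hm) (volume_exceptional_columns hA hfin l j a)
  have h' : ∀ᵐ B : Fin m → Fin n → ℝ, ∀ l j, ∀ᵐ a ∂(μH[(m : ℝ)].restrict A),
      (a, B) ∉ exceptionalPairs A l j := by
    simpa only [ae_all_iff] using h
  filter_upwards [h'] with B hB
  simpa only [ae_all_iff] using hB

/-- Almost every linear map to `ℝ^m` sends a compact purely unrectifiable set of finite measure
to a null set (Besicovitch–Federer). -/
theorem PurelyUnrectifiable.ae_volume_rowMap_image_eq_zero_of_isCompact {n m : ℕ} (hm : 1 ≤ m)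
    {A : Set (EuclideanSpace ℝ (Fin n))} (hA : IsCompact A) (hfin : μH[(m : ℝ)] A ≠ ∞)
    (hpu : PurelyUnrectifiable m A) :
    ∀ᵐ B : Fin m → Fin n → ℝ, volume (rowMap B '' A) = 0 := by
  have : IsFiniteMeasure (μH[(m : ℝ)].restrict A) :=
    isFiniteMeasure_restrict.2 hfin
  filter_upwards [ae_ae_notMem_exceptionalPairs (m := m) hA hfin] with B hB
  obtain ⟨K, hK⟩ := exists_lipschitzWith_rowMap B
  set N : Set (EuclideanSpace ℝ (Fin n)) :=
    {a ∈ A | ¬ ∀ l j, (a, B) ∉ exceptionalPairs A l j} with hN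
  set D₁ : Set (EuclideanSpace ℝ (Fin n)) := {a ∈ A | ∃ L, ∀ j, ∀ N : ℕ, ∃ k₀, ∀ k ≥ k₀, ∀ i,
    (μH[(m : ℝ)].restrict A) (fibreCone j (i + L) k a B) ≤
        ENNReal.ofReal (1 / (N + 1) * ((1 / 2) ^ (i + L + k)) ^ m)} with hD₁
  set D₂ : Set (EuclideanSpace ℝ (Fin n)) := {a ∈ A | ∃ L j, ¬ ∃ q : ℕ, ∀ k i,
    (μH[(m : ℝ)].restrict A) (fibreCone j (i + L) k a B) ≤
      ENNReal.ofReal (q * ((1 / 2) ^ (i + L + k)) ^ m)} with hD₂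
  set D₃ : Set (EuclideanSpace ℝ (Fin n)) := {a ∈ A | ∀ l, FibreHit A l a B} with hD₃
  have hsub : A ⊆ (N ∪ D₁) ∪ D₂ ∪ D₃ := by
    intro a ha
    by_contra hcon
    simp only [mem_union, not_or] at hcon
    obtain ⟨⟨⟨h0, h1⟩, h2⟩, h3⟩ := hcon
    have h3' : ∃ l, ¬ FibreHit A l a B := by
      by_contra! h; exact h3 ⟨ha, h⟩
    obtain ⟨l, hl⟩ := h3'
    have h0' : ∀ l j, (a, B) ∉ exceptionalPairs A l j := by
      by_contra h; exact h0 ⟨ha, h⟩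
    refine h1 ⟨ha, l, fun j => ?_⟩
    by_contra h
    refine h0' l j ⟨hl, ?_, h⟩
    by_contra h'
    exact h2 ⟨ha, l, j, h'⟩
  have hnull : ∀ C, μH[(m : ℝ)] C = 0 → volume (rowMap B '' C) = 0 := by
    intro C hC
    rw [← hausdorffMeasure_fin_real]
    refine le_antisymm ((hK.hausdorffMeasure_image_le (by positivity) C).trans ?_) (zero_le)
    rw [hC, mul_zero]
  have hN0 : μH[(m : ℝ)] N = 0 := by
    have h := (ae_restrict_iff' hA.measurableSet).1 hB
    rw [ae_iff] at h
    refine measure_mono_null ?_ h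
    rintro a ⟨ha, h⟩ hc
    exact h (hc ha)
  have hD₁0 : μH[(m : ℝ)] D₁ = 0 := by
    refine hpu.measure_eq_zero_of_cone hm hfin hK (fun a ha => ha.1) ?_
    rintro a ⟨-, L, hL⟩
    refine ⟨L, fun q hq => ?_⟩
    obtain ⟨N, hNq⟩ := exists_nat_one_div_lt hq
    choose k₀ hk₀ using fun j => hL j N
    refine ⟨Finset.univ.sup k₀, fun i hi j => ?_⟩
    have h := hk₀ j _ (Finset.le_sup (Finset.mem_univ j)) (i - L)
    rw [Nat.sub_add_cancel hi] at h
    refine h.trans (ENNReal.ofReal_le_ofReal ?_)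
    gcongr
  have hD₂0 : volume (rowMap B '' D₂) = 0 := by
    refine volume_image_eq_zero_of_infinite_density (continuous_rowMap B).measurable
      (μH[(m : ℝ)].restrict A) ?_
    rintro a ⟨-, L, j, h⟩ q
    push Not at h
    obtain ⟨k, i, hki⟩ := h q
    refine ⟨(1 / 2) ^ (i + L + k), by positivity, pow_le_one₀ (by norm_num) (by norm_num), ?_⟩
    rw [ENNReal.ofReal_mul (by positivity), ENNReal.ofReal_natCast] at hki
    refine hki.le.trans (measure_mono ?_)
    rintro x ⟨hx1, -, hx2⟩
    rw [mem_preimage, mem_closedBall, pow_add, mul_comm]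
    refine hx2.trans ?_
    gcongr
    refine le_trans ?_ hx1
    rw [dist_eq_norm, ← Real.norm_eq_abs]
    exact PiLp.norm_apply_le (x - a) j
  have hD₃0 : volume (rowMap B '' D₃) = 0 := by
    refine measure_mono_null ?_ (hK.volume_infinite_fibre_eq_zero hA.measurableSet hfin)
    rintro _ ⟨a, ⟨-, ha⟩, rfl⟩
    intro hf
    have hf' := hf.subset (sdiff_subset (t := {a}))
    have hcl : a ∉ closure ((A ∩ rowMap B ⁻¹' {rowMap B a}) \ {a}) := by
      rw [hf'.isClosed.closure_eq]
      exact fun h => h.2 rfl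
    refine hcl (Metric.mem_closure_iff.2 fun e he => ?_)
    obtain ⟨l, hl⟩ := exists_pow_lt_of_lt_one he (by norm_num : (1 / 2 : ℝ) < 1)
    obtain ⟨x, hxA, hx0, hxl, hxp⟩ := ha l
    refine ⟨x, ⟨⟨hxA, hxp⟩, fun h => ?_⟩, ?_⟩
    · rw [mem_singleton_iff] at h
      rw [h, dist_self] at hx0
      exact lt_irrefl _ hx0
    · rw [dist_comm]; exact hxl.trans_lt hl
  refine measure_mono_null (image_mono hsub) ?_
  rw [image_union, image_union, image_union]
  exact measure_union_null (measure_union_null (measure_union_null (hnull N hN0)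
    (hnull D₁ hD₁0)) hD₂0) hD₃0

/-- Almost every linear map to `ℝ^m` sends a purely unrectifiable Borel set of finite measure
to a null set (Besicovitch–Federer). -/
theorem PurelyUnrectifiable.ae_volume_rowMap_image_eq_zero {n m : ℕ} (hm : 1 ≤ m)
    {A : Set (EuclideanSpace ℝ (Fin n))} (hA : MeasurableSet A) (hfin : μH[(m : ℝ)] A ≠ ∞)
    (hpu : PurelyUnrectifiable m A) :
    ∀ᵐ B : Fin m → Fin n → ℝ, volume (rowMap B '' A) = 0 := by
  have : IsFiniteMeasure (μH[(m : ℝ)].restrict A) :=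
    isFiniteMeasure_restrict.2 hfin
  have hex : ∀ k : ℕ, ∃ C ⊆ A, IsCompact C ∧ (μH[(m : ℝ)].restrict A) (A \ C) < 1 / (k + 1) := by
    intro k
    exact hA.exists_isCompact_sdiff_lt (measure_ne_top _ _)
      (ENNReal.div_ne_zero.2 ⟨one_ne_zero, by finiteness⟩)
  choose C hCA hC hCk using hex
  have hae : ∀ᵐ B : Fin m → Fin n → ℝ, ∀ k, volume (rowMap B '' C k) = 0 := by
    rw [ae_all_iff]
    intro k
    refine PurelyUnrectifiable.ae_volume_rowMap_image_eq_zero_of_isCompact hm (hC k)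
      (measure_ne_top_of_subset (hCA k) hfin) fun g K hg => ?_
    exact measure_mono_null (inter_subset_inter_left _ (hCA k)) (hpu g K hg)
  have hrest : μH[(m : ℝ)] (A \ ⋃ k, C k) = 0 := by
    have h : ∀ k : ℕ, μH[(m : ℝ)] (A \ ⋃ k, C k) ≤ 1 / (k + 1) := by
      intro k
      have h1 := hCk k
      rw [Measure.restrict_apply (hA.diff (hC k).measurableSet),
        inter_eq_left.2 sdiff_subset] at h1
      exact (measure_mono (sdiff_subset_sdiff_right (subset_iUnion C k))).trans h1.le
    by_contra h0
    obtain ⟨k, hk⟩ := ENNReal.exists_inv_nat_lt h0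
    refine absurd (h k) (not_le.2 (lt_of_le_of_lt ?_ hk))
    rw [one_div]
    exact ENNReal.inv_le_inv.2 le_self_add
  filter_upwards [hae] with B hB
  obtain ⟨K, hK⟩ := exists_lipschitzWith_rowMap B
  have hsub : A ⊆ (⋃ k, C k) ∪ (A \ ⋃ k, C k) := by rw [union_sdiff_self]; exact subset_union_right
  refine measure_mono_null (image_mono hsub) ?_
  rw [image_union, image_iUnion]
  refine measure_union_null (measure_iUnion_null hB) ?_
  rw [← hausdorffMeasure_fin_real]
  refine le_antisymm ((hK.hausdorffMeasure_image_le (by positivity) _).trans ?_) (zero_le)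
  rw [hrest, mul_zero]

theorem ae_comp_embedding {n m : ℕ} (I : Fin m ↪ Fin n) {p : (Fin m → Fin n → ℝ) → Prop}
    (h : ∀ᵐ B, p B) : ∀ᵐ M : Fin n → Fin n → ℝ, p (M ∘ I) := by
  set N : Set (Fin m → Fin n → ℝ) := toMeasurable volume {B | ¬ p B} with hN
  have hN0 : volume N = 0 := by rw [hN, measure_toMeasurable]; exact ae_iff.1 h
  have hι : Measurable fun u : Fin m → Fin n → ℝ => Function.extend I u (0 : Fin n → Fin n → ℝ) := by
    refine measurable_pi_lambda _ fun i => ?_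
    by_cases hi : ∃ k, I k = i
    · obtain ⟨k, rfl⟩ := hi
      simp only [I.injective.extend_apply]
      exact measurable_pi_apply k
    · simp only [Function.extend_apply' _ _ _ hi]
      exact measurable_const
  have hmeas : Measurable fun M : Fin n → Fin n → ℝ => M ∘ I :=
    measurable_pi_lambda _ fun i => measurable_pi_apply (I i)
  have h0 : volume ((fun M : Fin n → Fin n → ℝ => M ∘ I) ⁻¹' N) = 0 := by
    refine measure_eq_zero_of_forall_translate volume volume hι
      (hmeas (measurableSet_toMeasurable _ _)) fun b => ?_
    have : {u : Fin m → Fin n → ℝ | b + Function.extend I u 0 ∈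
        (fun M : Fin n → Fin n → ℝ => M ∘ I) ⁻¹' N} = (fun u => b ∘ I + u) ⁻¹' N := by
      ext u
      simp only [mem_ofPred_eq, mem_preimage]
      rw [show (b + Function.extend I u 0) ∘ I = b ∘ I + u from ?_]
      ext k : 1
      simp [I.injective.extend_apply]
    rw [this, measure_preimage_add, hN0]
  rw [ae_iff]
  refine measure_mono_null ?_ h0
  intro M hM
  exact subset_toMeasurable volume {B | ¬ p B} hM

/-- Some matrix arbitrarily close to the identity has the property that all its `m`-row
submatrices send `Su` to null sets. -/
theorem exists_matrix_near_one_volume_image_eq_zero {n m : ℕ} (hm : 1 ≤ m)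
    {T Su Sr : Set (EuclideanSpace ℝ (Fin n))} (hT : MeasurableSet T)
    (hfin : μH[(m : ℝ)] T ≠ ∞) (hTS : T = Su ∪ Sr) (hu : PurelyUnrectifiable m Su)
    (hr : CountablyRectifiable m Sr) {e : ℝ} (he : 0 < e) :
    ∃ M : Fin n → Fin n → ℝ, (∀ i j, |M i j - if i = j then 1 else 0| < e) ∧
      ∀ I : Fin m ↪ Fin n, volume (rowMap (M ∘ I) '' Su) = 0 := by
  obtain ⟨g, hg, hg0⟩ := hr
  set F : Set (EuclideanSpace ℝ (Fin n)) := ⋃ i, range (g i) with hF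
  have hFmeas : MeasurableSet F := by
    refine MeasurableSet.iUnion fun i => ?_
    obtain ⟨C, hC⟩ := hg i
    rw [← image_univ, ← iUnion_closedBall_nat (0 : EuclideanSpace ℝ (Fin m)), image_iUnion]
    exact MeasurableSet.iUnion fun k =>
      ((isCompact_closedBall _ _).image hC.continuous).measurableSet
  have hSuF : μH[(m : ℝ)] (Su ∩ F) = 0 := by
    rw [hF, inter_iUnion]
    refine measure_iUnion_null fun i => ?_
    obtain ⟨C, hC⟩ := hg i
    exact hu (g i) C hC
  have hpu : PurelyUnrectifiable m (T \ F) := by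
    intro f C hf
    refine measure_mono_null ?_ (measure_union_null (hu f C hf) hg0)
    rintro x ⟨⟨hxT, hxF⟩, hxf⟩
    rw [hTS] at hxT
    exact hxT.imp (fun h => ⟨h, hxf⟩) (fun h => ⟨h, hxF⟩)
  have hae : ∀ᵐ M : Fin n → Fin n → ℝ, ∀ I : Fin m ↪ Fin n,
      volume (rowMap (M ∘ I) '' (T \ F)) = 0 := by
    rw [ae_all_iff]
    intro I
    exact ae_comp_embedding I (hpu.ae_volume_rowMap_image_eq_zero hm (hT.diff hFmeas)
      (measure_ne_top_of_subset sdiff_subset hfin))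
  have hball : volume (ball (fun i j : Fin n => if i = j then (1 : ℝ) else 0) e) ≠ 0 :=
    (measure_ball_pos _ _ he).ne'
  obtain ⟨M, hM, hMI⟩ : ∃ M ∈ ball (fun i j : Fin n => if i = j then (1 : ℝ) else 0) e,
      ∀ I : Fin m ↪ Fin n, volume (rowMap (M ∘ I) '' (T \ F)) = 0 := by
    by_contra! hcon
    refine hball (measure_mono_null ?_ (ae_iff.1 hae))
    intro M hM hMI
    obtain ⟨I, hI⟩ := hcon M hM
    exact hI (hMI I)
  refine ⟨M, fun i j => ?_, fun I => ?_⟩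
  · have := (dist_pi_lt_iff he).1 ((dist_pi_lt_iff he).1 hM i) j
    rwa [Real.dist_eq] at this
  · obtain ⟨K, hK⟩ := exists_lipschitzWith_rowMap (M ∘ I)
    have hsub : Su ⊆ (T \ F) ∪ (Su ∩ F) := by
      intro x hx
      by_cases hxF : x ∈ F
      · exact Or.inr ⟨hx, hxF⟩
      · exact Or.inl ⟨hTS ▸ Or.inl hx, hxF⟩
    refine measure_mono_null (image_mono hsub) ?_
    rw [image_union]
    refine measure_union_null (hMI I) ?_
    rw [← hausdorffMeasure_fin_real]
    refine le_antisymm ((hK.hausdorffMeasure_image_le (by positivity) _).trans ?_) (zero_le)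
    rw [hSuF, mul_zero]

theorem exists_norm_deriv_smoothTransition_le :
    ∃ K : ℝ≥0, ∀ t, ‖deriv Real.smoothTransition t‖₊ ≤ K := by
  have hc : Continuous (deriv Real.smoothTransition) :=
    (Real.smoothTransition.contDiff (n := (⊤ : ℕ∞))).continuous_deriv (by simp)
  obtain ⟨K, hK⟩ := (isCompact_Icc (a := (0 : ℝ)) (b := 1)).exists_bound_of_continuousOn
    hc.continuousOn
  refine ⟨K.toNNReal, fun t => ?_⟩
  rw [← NNReal.coe_le_coe, coe_nnnorm]
  have hK0 : 0 ≤ (K.toNNReal : ℝ) := by positivity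
  rcases lt_or_ge t 0 with ht | ht
  · have : Real.smoothTransition =ᶠ[𝓝 t] fun _ => 0 := by
      filter_upwards [Iio_mem_nhds ht] with s hs
      exact Real.smoothTransition.zero_of_nonpos (le_of_lt hs)
    rw [this.deriv_eq, deriv_const, norm_zero]
    exact hK0
  rcases lt_or_ge 1 t with ht1 | ht1
  · have : Real.smoothTransition =ᶠ[𝓝 t] fun _ => 1 := by
      filter_upwards [Ioi_mem_nhds ht1] with s hs
      exact Real.smoothTransition.one_of_one_le (le_of_lt hs)
    rw [this.deriv_eq, deriv_const, norm_zero]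
    exact hK0
  · exact (hK t ⟨ht, ht1⟩).trans (Real.le_coe_toNNReal K)

/-- A smooth approximation of the identity that is locally constant with integer values off the
`η`-neighbourhoods to the right of the integers. -/
def smoothStep (η t : ℝ) : ℝ :=
  ⌊t⌋ + Real.smoothTransition (Int.fract t / η)

theorem smoothStep_intCast (η : ℝ) (k : ℤ) : smoothStep η k = k := by
  simp [smoothStep]

theorem abs_smoothStep_sub_le (η t : ℝ) : |smoothStep η t - t| ≤ 1 := by
  have h1 := Real.smoothTransition.nonneg (Int.fract t / η)
  have h2 := Real.smoothTransition.le_one (Int.fract t / η)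
  have h3 := Int.floor_le t
  have h4 := Int.lt_floor_add_one t
  rw [smoothStep, abs_le]
  constructor <;> linarith

theorem smoothStep_eq_intCast {η t : ℝ} (hη : 0 < η) (ht : η ≤ Int.fract t) :
    smoothStep η t = ((⌊t⌋ + 1 : ℤ) : ℝ) := by
  rw [smoothStep, Real.smoothTransition.one_of_one_le ((one_le_div hη).2 ht)]
  push_cast
  rfl

theorem smoothStep_eventuallyEq {η : ℝ} (hη : 0 < η) (hη1 : η < 1) (t : ℝ) :
    smoothStep η =ᶠ[𝓝 t] fun s => ⌊t⌋ + Real.smoothTransition ((s - ⌊t⌋) / η) := by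
  have h3 := Int.floor_le t
  have h4 := Int.lt_floor_add_one t
  filter_upwards [Ioo_mem_nhds (show (⌊t⌋ : ℝ) - (1 - η) < t by linarith) h4] with s hs
  rcases le_or_gt (⌊t⌋ : ℝ) s with h | h
  · have : ⌊s⌋ = ⌊t⌋ := Int.floor_eq_iff.2 ⟨h, hs.2⟩
    rw [smoothStep, Int.fract, this]
  · have hfl : ⌊s⌋ = ⌊t⌋ - 1 := by
      refine Int.floor_eq_iff.2 ⟨?_, ?_⟩ <;> push_cast <;> linarith [hs.1]
    have hfr : η ≤ Int.fract s := by
      rw [Int.fract, hfl]; push_cast; linarith [hs.1]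
    rw [smoothStep_eq_intCast hη hfr, hfl, Real.smoothTransition.zero_of_nonpos
      (div_nonpos_of_nonpos_of_nonneg (by linarith) hη.le)]
    push_cast
    ring

theorem contDiff_smoothStep {η : ℝ} (hη : 0 < η) (hη1 : η < 1) :
    ContDiff ℝ (⊤ : ℕ∞) (smoothStep η) := by
  rw [contDiff_iff_contDiffAt]
  intro t
  refine ContDiffAt.congr_of_eventuallyEq ?_ (smoothStep_eventuallyEq hη hη1 t)
  refine ContDiff.contDiffAt ?_
  have : ContDiff ℝ (⊤ : ℕ∞) fun s : ℝ => (s - ⌊t⌋) / η := by fun_prop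
  exact contDiff_const.add (Real.smoothTransition.contDiff.comp this)

theorem lipschitzWith_smoothStep {η : ℝ≥0} (hη : 0 < η) (hη1 : η < 1) {K : ℝ≥0}
    (hK : ∀ t, ‖deriv Real.smoothTransition t‖₊ ≤ K) : LipschitzWith (K / η) (smoothStep η) := by
  refine lipschitzWith_of_nnnorm_deriv_le
    ((contDiff_smoothStep hη hη1).differentiable (by simp)) fun t => ?_
  have h0 := (smoothStep_eventuallyEq hη hη1 t).deriv_eq
  have h1 : HasDerivAt (fun s : ℝ => (s - ⌊t⌋) / η) (1 / (η : ℝ)) t :=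
    ((hasDerivAt_id t).sub_const _).div_const _
  have h2 := ((Real.smoothTransition.contDiff (n := (⊤ : ℕ∞))).differentiable (by simp)
    ((t - ⌊t⌋) / η)).hasDerivAt.comp t h1
  have h3 := h2.const_add (⌊t⌋ : ℝ)
  refine le_of_eq_of_le (congrArg _ (h0.trans h3.deriv)) ?_
  rw [nnnorm_mul, one_div, nnnorm_inv, div_eq_mul_inv K]
  refine mul_le_mul (hK _) (le_of_eq ?_) (zero_le) (zero_le)
  simp

/-- The smooth map of `ℝⁿ` collapsing most of each cell of the grid of side length `δ`,
translated according to `τ`, to a vertex of the grid. -/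
def gridMap {n : ℕ} (η δ : ℝ) (τ y : Fin n → ℝ) : Fin n → ℝ :=
  fun i => δ * (smoothStep η (y i / δ + τ i) - τ i)

theorem contDiff_gridMap {n : ℕ} {η : ℝ} (hη : 0 < η) (hη1 : η < 1) (δ : ℝ) (τ : Fin n → ℝ) :
    ContDiff ℝ (⊤ : ℕ∞) (gridMap η δ τ) := by
  refine contDiff_pi.2 fun i => ?_
  have h1 : ContDiff ℝ (⊤ : ℕ∞) fun y : Fin n → ℝ => y i / δ + τ i := by fun_prop
  exact contDiff_const.mul (((contDiff_smoothStep hη hη1).comp h1).sub contDiff_const)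

theorem lipschitzWith_gridMap {n : ℕ} {η : ℝ≥0} (hη : 0 < η) (hη1 : η < 1) {K : ℝ≥0}
    (hK : ∀ t, ‖deriv Real.smoothTransition t‖₊ ≤ K) {δ : ℝ} (hδ : 0 < δ) (τ : Fin n → ℝ) :
    LipschitzWith (K / η) (gridMap η δ τ) := by
  refine LipschitzWith.of_dist_le_mul fun x y => ?_
  refine (dist_pi_le_iff (by positivity)).2 fun i => ?_
  have h := (lipschitzWith_smoothStep hη hη1 hK).dist_le_mul (x i / δ + τ i) (y i / δ + τ i)
  rw [Real.dist_eq, Real.dist_eq] at h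
  rw [gridMap, gridMap, Real.dist_eq, ← mul_sub, abs_mul, abs_of_pos hδ, sub_sub_sub_cancel_right]
  calc δ * |smoothStep η (x i / δ + τ i) - smoothStep η (y i / δ + τ i)|
      ≤ δ * ((K / η : ℝ≥0) * |x i / δ + τ i - (y i / δ + τ i)|) := by gcongr
    _ = (K / η : ℝ≥0) * |x i - y i| := by
        rw [add_sub_add_right_eq_sub, ← sub_div, abs_div, abs_of_pos hδ]
        field_simp
    _ ≤ _ := by
        gcongr
        rw [← Real.dist_eq]
        exact dist_le_pi_dist x y i

theorem dist_gridMap_self_le {n : ℕ} (η : ℝ) {δ : ℝ} (hδ : 0 < δ) (τ y : Fin n → ℝ) :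
    dist (gridMap η δ τ y) y ≤ δ := by
  refine (dist_pi_le_iff hδ.le).2 fun i => ?_
  have h := abs_smoothStep_sub_le η (y i / δ + τ i)
  have : gridMap η δ τ y i - y i = δ * (smoothStep η (y i / δ + τ i) - (y i / δ + τ i)) := by
    rw [gridMap]
    field_simp
    ring
  rw [Real.dist_eq, this, abs_mul, abs_of_pos hδ]
  exact mul_le_of_le_one_right hδ.le h

/-- If all coordinates outside the range of `I` lie in the collapsed part of the grid, then the
image of `gridMap` is controlled by the projection to the coordinates `I`. -/
theorem hausdorffMeasure_gridMap_image_eq_zero {n k : ℕ} {d : ℝ} (hd : 0 ≤ d) {η : ℝ≥0}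
    (hη : 0 < η) (hη1 : η < 1) {δ : ℝ} (hδ : 0 < δ) (τ : Fin n → ℝ) (I : Fin k ↪ Fin n)
    {E : Set (Fin n → ℝ)} (hE : ∀ y ∈ E, ∀ i ∉ range I, (η : ℝ) ≤ Int.fract (y i / δ + τ i))
    (h0 : μH[d] ((fun (y : Fin n → ℝ) (i : Fin k) => y (I i)) '' E) = 0) :
    μH[d] (gridMap η δ τ '' E) = 0 := by
  obtain ⟨K, hK⟩ := exists_norm_deriv_smoothTransition_le
  set emb : (Fin n → ℤ) → (Fin k → ℝ) → Fin n → ℝ := fun z w =>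
    Function.extend I w fun i => δ * (z i - τ i) with hemb
  have hlip : ∀ z, LipschitzWith 1 (emb z) := by
    intro z
    refine LipschitzWith.of_dist_le_mul fun v w => ?_
    rw [NNReal.coe_one, one_mul]
    refine (dist_pi_le_iff dist_nonneg).2 fun i => ?_
    by_cases hi : ∃ l, I l = i
    · obtain ⟨l, rfl⟩ := hi
      simp only [hemb, I.injective.extend_apply]
      exact dist_le_pi_dist v w l
    · simp only [hemb, Function.extend_apply' _ _ _ hi, dist_self]
      exact dist_nonneg
  have hsub : gridMap η δ τ '' E ⊆ ⋃ z : Fin n → ℤ, (gridMap η δ τ ∘ emb z) ''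
      ((fun (y : Fin n → ℝ) (i : Fin k) => y (I i)) '' E) := by
    rintro _ ⟨y, hy, rfl⟩
    refine mem_iUnion.2 ⟨fun i => ⌊y i / δ + τ i⌋ + 1, _, ⟨y, hy, rfl⟩, ?_⟩
    ext i
    by_cases hi : ∃ l, I l = i
    · obtain ⟨l, rfl⟩ := hi
      simp only [gridMap, Function.comp_apply, hemb, I.injective.extend_apply]
    · simp only [gridMap, Function.comp_apply, hemb, Function.extend_apply' _ _ _ hi]
      rw [smoothStep_eq_intCast (NNReal.coe_pos.2 hη) (hE y hy i hi), mul_div_cancel_left₀ _ hδ.ne', sub_add_cancel,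
        smoothStep_intCast]
  refine measure_mono_null hsub (measure_iUnion_null fun z => ?_)
  refine le_antisymm (((((lipschitzWith_gridMap hη hη1 hK hδ τ).comp
    (hlip z))).hausdorffMeasure_image_le hd _).trans ?_) (zero_le)
  rw [h0, mul_zero]

theorem EuclideanSpace.dist_le_mul_of_forall {n : ℕ} {c : ℝ} (hc : 0 ≤ c)
    {x y : EuclideanSpace ℝ (Fin n)} (h : ∀ j, |x j - y j| ≤ c) : dist x y ≤ n * c := by
  rw [EuclideanSpace.dist_eq]
  refine Real.sqrt_le_iff.2 ⟨by positivity, ?_⟩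
  calc ∑ j, dist (x j) (y j) ^ 2 ≤ ∑ _j : Fin n, c ^ 2 := by
        refine Finset.sum_le_sum fun j _ => ?_
        rw [Real.dist_eq]
        have := h j
        gcongr
    _ = n * c ^ 2 := by simp
    _ ≤ (n * c) ^ 2 := by
        rw [mul_pow]
        gcongr
        rcases Nat.eq_zero_or_pos n with h0 | h0
        · simp [h0]
        · exact le_self_pow₀ (by exact_mod_cast h0) (by norm_num)

/-- A matrix close to the identity defines a linear isomorphism with Lipschitz constants
depending only on the dimension. -/
theorem exists_continuousLinearEquiv_of_near_one {n : ℕ} (hn : 0 < n) {M : Fin n → Fin n → ℝ}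
    (hM : ∀ i j, |M i j - if i = j then 1 else 0| < 1 / (2 * n)) :
    ∃ A : EuclideanSpace ℝ (Fin n) ≃L[ℝ] (Fin n → ℝ), (∀ x, A x = rowMap M x) ∧
      LipschitzWith 2 A ∧ LipschitzWith (2 * n) A.symm := by
  let f : EuclideanSpace ℝ (Fin n) →ₗ[ℝ] (Fin n → ℝ) :=
    { toFun := rowMap M
      map_add' := fun x y => by ext i; simp [rowMap, mul_add, Finset.sum_add_distrib]
      map_smul' := fun c x => by ext i; simp [rowMap, Finset.mul_sum, mul_left_comm] }
  have hf : ∀ x, f x = rowMap M x := fun x => rfl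
  have hn' : (0 : ℝ) < n := by exact_mod_cast hn
  have key : ∀ (x : EuclideanSpace ℝ (Fin n)) (i : Fin n),
      |f x i - x i| ≤ 1 / 2 * ‖WithLp.ofLp x‖ := by
    intro x i
    have : f x i - x i = ∑ j, (M i j - if i = j then 1 else 0) * x j := by
      simp [hf, rowMap, sub_mul, Finset.sum_sub_distrib]
    rw [this]
    calc |∑ j, (M i j - if i = j then 1 else 0) * x j|
        ≤ ∑ j, |(M i j - if i = j then 1 else 0) * x j| := Finset.abs_sum_le_sum_abs _ _
      _ ≤ ∑ _j : Fin n, 1 / (2 * n) * ‖WithLp.ofLp x‖ := by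
          refine Finset.sum_le_sum fun j _ => ?_
          rw [abs_mul]
          refine mul_le_mul (hM i j).le ?_ (abs_nonneg _) (by positivity)
          exact norm_le_pi_norm (WithLp.ofLp x) j
      _ = 1 / 2 * ‖WithLp.ofLp x‖ := by
          simp
          field_simp
  have hsup : ∀ x : EuclideanSpace ℝ (Fin n), ‖WithLp.ofLp x‖ ≤ ‖x‖ := fun x =>
    (pi_norm_le_iff_of_nonneg (norm_nonneg _)).2 fun i => PiLp.norm_apply_le x i
  have hup : ∀ x, ‖f x‖ ≤ 2 * ‖x‖ := by
    intro x
    refine (pi_norm_le_iff_of_nonneg (by positivity)).2 fun i => ?_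
    have h1 := key x i
    have h2 := norm_le_pi_norm (WithLp.ofLp x) i
    have h3 := hsup x
    rw [Real.norm_eq_abs] at h2 ⊢
    have h4 := abs_add_le (f x i - x i) (x i)
    rw [sub_add_cancel] at h4
    linarith [norm_nonneg x]
  have hlow : ∀ x, ‖WithLp.ofLp x‖ ≤ 2 * ‖f x‖ := by
    intro x
    have : ‖WithLp.ofLp x‖ ≤ 1 / 2 * ‖WithLp.ofLp x‖ + ‖f x‖ := by
      refine (pi_norm_le_iff_of_nonneg (by positivity)).2 fun i => ?_
      have h1 := key x i
      have h2 := norm_le_pi_norm (f x) i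
      rw [Real.norm_eq_abs] at h2 ⊢
      have h4 := abs_sub (f x i) (f x i - x i)
      rw [sub_sub_cancel] at h4
      linarith
    linarith
  have hinj : Function.Injective f := by
    rw [← LinearMap.ker_eq_bot, LinearMap.ker_eq_bot']
    intro x hx
    have h := hlow x
    rw [hx, norm_zero, mul_zero] at h
    have h' := norm_le_zero_iff.1 h
    ext i
    exact congrFun h' i
  let e : EuclideanSpace ℝ (Fin n) ≃ₗ[ℝ] (Fin n → ℝ) :=
    LinearEquiv.ofInjectiveOfFinrankEq f hinj (by simp)
  have he : ∀ x, e x = f x := fun x => rfl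
  refine ⟨e.toContinuousLinearEquiv, fun x => rfl, ?_, ?_⟩
  · refine LipschitzWith.of_dist_le_mul fun x y => ?_
    rw [dist_eq_norm, dist_eq_norm, ← map_sub]
    exact hup (x - y)
  · refine LipschitzWith.of_dist_le_mul fun x y => ?_
    have h1 : ∀ j, |e.symm x j - e.symm y j| ≤ 2 * dist x y := by
      intro j
      have h := (norm_le_pi_norm (WithLp.ofLp (e.symm x - e.symm y)) j).trans
        (hlow (e.symm x - e.symm y))
      rw [← he, map_sub, e.apply_symm_apply, e.apply_symm_apply, ← dist_eq_norm] at h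
      exact h
    have := EuclideanSpace.dist_le_mul_of_forall (by positivity) h1
    calc dist (e.symm x) (e.symm y) ≤ n * (2 * dist x y) := this
      _ = _ := by push_cast; ring

theorem volume_restrict_Icc_fract_add_lt_le {η : ℝ} (hη0 : 0 ≤ η) (c : ℝ) :
    (volume.restrict (Icc (0 : ℝ) 1)) {t | Int.fract (c + t) < η} ≤ ENNReal.ofReal (2 * η) := by
  have hmeas : MeasurableSet {t : ℝ | Int.fract (c + t) < η} :=
    measurableSet_lt (by fun_prop) measurable_const
  rw [Measure.restrict_apply hmeas]
  have hsub : {t : ℝ | Int.fract (c + t) < η} ∩ Icc 0 1 ⊆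
      Icc (⌊c⌋ - c) (⌊c⌋ - c + η) ∪ Icc (⌊c⌋ + 1 - c) (⌊c⌋ + 1 - c + η) := by
    rintro t ⟨ht, ht0, ht1⟩
    rw [mem_ofPred_eq, Int.fract] at ht
    have h1 := Int.floor_le (c + t)
    have h2 := Int.floor_le c
    have h3 := Int.lt_floor_add_one c
    have hlo : ⌊c⌋ ≤ ⌊c + t⌋ := Int.floor_le_floor (by linarith)
    have hhi : ⌊c + t⌋ < ⌊c⌋ + 2 := by
      have : (⌊c + t⌋ : ℝ) < ⌊c⌋ + 2 := by linarith
      exact_mod_cast this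
    obtain h | h : ⌊c + t⌋ = ⌊c⌋ ∨ ⌊c + t⌋ = ⌊c⌋ + 1 := by omega
    · rw [h] at h1 ht
      exact Or.inl ⟨by linarith, by linarith⟩
    · rw [h] at h1 ht
      push_cast at h1 ht
      exact Or.inr ⟨by linarith, by linarith⟩
  calc volume ({t : ℝ | Int.fract (c + t) < η} ∩ Icc 0 1)
      ≤ volume (Icc (⌊c⌋ - c) (⌊c⌋ - c + η) ∪ Icc (⌊c⌋ + 1 - c) (⌊c⌋ + 1 - c + η)) :=
        measure_mono hsub
    _ ≤ _ := measure_union_le _ _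
    _ = ENNReal.ofReal (2 * η) := by
        rw [Real.volume_Icc, Real.volume_Icc, ← ENNReal.ofReal_add (by linarith) (by linarith)]
        congr 1
        ring

/-- The uniform probability measure on the unit cube. -/
def cubeMeasure (n : ℕ) : Measure (Fin n → ℝ) :=
  Measure.pi fun _ => volume.restrict (Icc (0 : ℝ) 1)

theorem isProbabilityMeasure_cubeMeasure (n : ℕ) : IsProbabilityMeasure (cubeMeasure n) := by
  have : IsProbabilityMeasure (volume.restrict (Icc (0 : ℝ) 1)) := ⟨by simp⟩
  unfold cubeMeasure
  infer_instance

theorem cubeMeasure_forall_fract_lt_le {n : ℕ} {η : ℝ} (hη0 : 0 ≤ η)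
    (s : Finset (Fin n)) (c : Fin n → ℝ) :
    cubeMeasure n {τ | ∀ i ∈ s, Int.fract (c i + τ i) < η} ≤
      ENNReal.ofReal (2 * η) ^ s.card := by
  have : IsProbabilityMeasure (volume.restrict (Icc (0 : ℝ) 1)) := ⟨by simp⟩
  have heq : {τ : Fin n → ℝ | ∀ i ∈ s, Int.fract (c i + τ i) < η} =
      univ.pi fun i => if i ∈ s then {t | Int.fract (c i + t) < η} else univ := by
    ext τ
    simp only [mem_ofPred_eq, mem_univ_pi]
    refine forall_congr' fun i => ?_
    split_ifs with h <;> simp [h]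
  rw [heq, cubeMeasure, Measure.pi_pi]
  calc ∏ i, (volume.restrict (Icc (0 : ℝ) 1))
        (if i ∈ s then {t | Int.fract (c i + t) < η} else univ)
      ≤ ∏ i, if i ∈ s then ENNReal.ofReal (2 * η) else 1 := by
        refine Finset.prod_le_prod' fun i _ => ?_
        split_ifs
        · exact volume_restrict_Icc_fract_add_lt_le hη0 _
        · exact prob_le_one
    _ = ENNReal.ofReal (2 * η) ^ s.card := by
        rw [Finset.prod_ite_mem, Finset.univ_inter, Finset.prod_const]

/-- The coordinates of `y` lying in the part of the shifted grid which is not collapsed. -/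
def gridIndices {n : ℕ} (η : ℝ) (y : Fin n → ℝ) : Finset (Fin n) :=
  {i | Int.fract (y i) < η}

theorem measurableSet_forall_fract_lt {n : ℕ} (η : ℝ) (s : Finset (Fin n)) :
    MeasurableSet {y : Fin n → ℝ | ∀ i ∈ s, Int.fract (y i) < η} := by
  have : {y : Fin n → ℝ | ∀ i ∈ s, Int.fract (y i) < η} =
      ⋂ i ∈ s, {y | Int.fract (y i) < η} := by ext; simp
  rw [this]
  exact Finset.measurableSet_biInter _ fun i _ =>
    measurableSet_lt ((measurable_pi_apply i).fract) measurable_const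

theorem le_card_gridIndices_iff {n : ℕ} {η : ℝ} {k : ℕ} {y : Fin n → ℝ} :
    k ≤ (gridIndices η y).card ↔
      ∃ s ∈ Finset.powersetCard k (Finset.univ : Finset (Fin n)),
        ∀ i ∈ s, Int.fract (y i) < η := by
  constructor
  · intro h
    obtain ⟨s, hs, hsk⟩ := Finset.exists_subset_card_eq h
    refine ⟨s, by simp [hsk], fun i hi => ?_⟩
    simpa [gridIndices] using hs hi
  · rintro ⟨s, hs, h⟩
    rw [← (Finset.mem_powersetCard.1 hs).2]
    exact Finset.card_le_card fun i hi => by simpa [gridIndices] using h i hi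

theorem measurableSet_le_card_gridIndices {n : ℕ} (η : ℝ) (k : ℕ) :
    MeasurableSet {y : Fin n → ℝ | k ≤ (gridIndices η y).card} := by
  have : {y : Fin n → ℝ | k ≤ (gridIndices η y).card} =
      ⋃ s ∈ Finset.powersetCard k (Finset.univ : Finset (Fin n)),
        {y | ∀ i ∈ s, Int.fract (y i) < η} := by
    ext y
    simp only [mem_ofPred_eq, le_card_gridIndices_iff, mem_iUnion, exists_prop]
  rw [this]
  exact Finset.measurableSet_biUnion _ fun s _ => measurableSet_forall_fract_lt η s

/-- On average over the translations, few points have `k` non-collapsed coordinates. -/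
theorem lintegral_measure_le_card_gridIndices {n : ℕ} {X : Type*} [MeasurableSpace X]
    (ν : Measure X) [IsFiniteMeasure ν] {y : X → Fin n → ℝ} (hy : Measurable y) {η : ℝ}
    (hη0 : 0 ≤ η) (k : ℕ) :
    Measurable (fun τ => ν {x | k ≤ (gridIndices η (y x + τ)).card}) ∧
    ∫⁻ τ, ν {x | k ≤ (gridIndices η (y x + τ)).card} ∂(cubeMeasure n) ≤
      2 ^ n * ENNReal.ofReal (2 * η) ^ k * ν univ := by
  have := isProbabilityMeasure_cubeMeasure n
  have hadd : Measurable fun z : (Fin n → ℝ) × X => y z.2 + z.1 :=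
    (hy.comp measurable_snd).add measurable_fst
  have hS : MeasurableSet {z : (Fin n → ℝ) × X | k ≤ (gridIndices η (y z.2 + z.1)).card} :=
    hadd (measurableSet_le_card_gridIndices η k)
  have hs : ∀ s : Finset (Fin n), MeasurableSet
      {z : (Fin n → ℝ) × X | ∀ i ∈ s, Int.fract ((y z.2 + z.1) i) < η} := fun s =>
    hadd (measurableSet_forall_fract_lt η s)
  refine ⟨measurable_measure_prodMk_left hS, ?_⟩
  have h1 : ∫⁻ τ, ν {x | k ≤ (gridIndices η (y x + τ)).card} ∂(cubeMeasure n) =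
      ((cubeMeasure n).prod ν) {z | k ≤ (gridIndices η (y z.2 + z.1)).card} :=
    (Measure.prod_apply hS).symm
  have h2 : ∀ s ∈ Finset.powersetCard k (Finset.univ : Finset (Fin n)),
      ((cubeMeasure n).prod ν) {z | ∀ i ∈ s, Int.fract ((y z.2 + z.1) i) < η} ≤
        ENNReal.ofReal (2 * η) ^ k * ν univ := by
    intro s hsk
    rw [Measure.prod_apply_symm (hs s), ← lintegral_const]
    refine lintegral_mono fun x => ?_
    rw [← (Finset.mem_powersetCard.1 hsk).2]
    exact cubeMeasure_forall_fract_lt_le hη0 s (y x)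
  rw [h1]
  calc ((cubeMeasure n).prod ν) {z | k ≤ (gridIndices η (y z.2 + z.1)).card}
      ≤ ((cubeMeasure n).prod ν) (⋃ s ∈ Finset.powersetCard k (Finset.univ : Finset (Fin n)),
          {z | ∀ i ∈ s, Int.fract ((y z.2 + z.1) i) < η}) := by
        refine measure_mono fun z hz => ?_
        obtain ⟨s, hs, h⟩ := le_card_gridIndices_iff.1 hz
        exact mem_iUnion₂.2 ⟨s, hs, h⟩
    _ ≤ ∑ s ∈ Finset.powersetCard k (Finset.univ : Finset (Fin n)),
          ((cubeMeasure n).prod ν) {z | ∀ i ∈ s, Int.fract ((y z.2 + z.1) i) < η} :=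
        measure_biUnion_finset_le _ _
    _ ≤ ∑ _s ∈ Finset.powersetCard k (Finset.univ : Finset (Fin n)),
          ENNReal.ofReal (2 * η) ^ k * ν univ := Finset.sum_le_sum h2
    _ = (n.choose k : ℝ≥0∞) * (ENNReal.ofReal (2 * η) ^ k * ν univ) := by
        rw [Finset.sum_const, Finset.card_powersetCard, Finset.card_univ, Fintype.card_fin,
          nsmul_eq_mul]
    _ ≤ 2 ^ n * (ENNReal.ofReal (2 * η) ^ k * ν univ) := by
        gcongr
        exact_mod_cast Nat.choose_le_two_pow n k
    _ = _ := by ring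

theorem exists_le_two_mul_and_le_two_mul {Ω : Type*} [MeasurableSpace Ω] (P : Measure Ω)
    [IsProbabilityMeasure P] {f g : Ω → ℝ≥0∞} (hf : Measurable f) (hg : Measurable g)
    {a b : ℝ≥0∞} (ha : a ≠ ∞) (hb : b ≠ ∞) (hfa : ∫⁻ ω, f ω ∂P ≤ a) (hgb : ∫⁻ ω, g ω ∂P ≤ b) :
    ∃ ω, f ω ≤ 2 * a ∧ g ω ≤ 2 * b := by
  have hint : ∫⁻ ω, (f ω * a⁻¹ + g ω * b⁻¹) ∂P ≤ 2 := by
    rw [lintegral_add_left (hf.mul_const _), lintegral_mul_const _ hf, lintegral_mul_const _ hg,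
      ← one_add_one_eq_two]
    refine add_le_add ?_ ?_
    · exact (mul_le_mul_left hfa _).trans (ENNReal.mul_inv_le_one _)
    · exact (mul_le_mul_left hgb _).trans (ENNReal.mul_inv_le_one _)
  obtain ⟨ω, hω⟩ := exists_le_lintegral (μ := P)
    ((hf.mul_const a⁻¹).add (hg.mul_const b⁻¹)).aemeasurable
  have hω2 : f ω * a⁻¹ + g ω * b⁻¹ ≤ 2 := hω.trans hint
  have key : ∀ {x c : ℝ≥0∞}, c ≠ ∞ → x * c⁻¹ ≤ 2 → x ≤ 2 * c := by
    intro x c hc h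
    rw [← div_eq_mul_inv] at h
    exact (ENNReal.div_le_iff_le_mul (Or.inr (by norm_num)) (Or.inl hc)).1 h
  exact ⟨ω, key ha (le_self_add.trans hω2), key hb (le_add_self.trans hω2)⟩

/-- A composition of maps, each acting in its own member of a disjoint family of sets. -/
theorem foldr_comp_apply_of_pairwise_disjoint {ι X : Type*} {h : ι → X → X} {V : ι → Set X}
    (hV : ∀ c x, x ∉ V c → h c x = x) (hm : ∀ c, MapsTo (h c) (V c) (V c)) (l : List ι)
    (hl : l.Pairwise fun c c' => Disjoint (V c) (V c')) (x : X) :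
    ((∀ c ∈ l, x ∉ V c) → (l.map h).foldr (· ∘ ·) id x = x) ∧
      ∀ c ∈ l, x ∈ V c → (l.map h).foldr (· ∘ ·) id x = h c x := by
  induction l with
  | nil => simp
  | cons b l ih =>
    rw [List.pairwise_cons] at hl
    obtain ⟨ih1, ih2⟩ := ih hl.2
    simp only [List.map_cons, List.foldr_cons, Function.comp_apply]
    refine ⟨fun hx => ?_, fun c hc hxc => ?_⟩
    · rw [ih1 fun c hc => hx c (List.mem_cons_of_mem _ hc), hV b x (hx b List.mem_cons_self)]
    · rcases List.mem_cons.1 hc with rfl | hc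
      · rw [ih1 fun c' hc' hx' => (hl.1 c' hc').ne_of_mem hxc hx' rfl]
      · rw [ih2 c hc hxc]
        exact hV b _ fun hb => (hl.1 c hc).ne_of_mem hb (hm c hxc) rfl

theorem contDiff_foldr_comp {E : Type*} [NormedAddCommGroup E] [NormedSpace ℝ E]
    {k : WithTop ℕ∞} (l : List (E → E)) (hl : ∀ h ∈ l, ContDiff ℝ k h) :
    ContDiff ℝ k (l.foldr (· ∘ ·) id) := by
  induction l with
  | nil => exact contDiff_id
  | cons b l ih =>
    exact (hl b List.mem_cons_self).comp (ih fun h hh => hl h (List.mem_cons_of_mem _ hh))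

/-- A map close to the identity can be cut off to an admissible deformation, without changing it
on a given finite disjoint family of closed balls. -/
theorem exists_isAdmissibleDeformation_eqOn_closedBall {n : ℕ}
    {G : Set (EuclideanSpace ℝ (Fin n))} (hG : IsOpen G)
    (t : Finset (EuclideanSpace ℝ (Fin n))) {r : EuclideanSpace ℝ (Fin n) → ℝ}
    (hr : ∀ c ∈ t, 0 < r c) (hrG : ∀ c ∈ t, closedBall c (r c) ⊆ G)
    (hdisj : (t : Set (EuclideanSpace ℝ (Fin n))).PairwiseDisjoint
      fun c => closedBall c (r c)) :
    ∃ d : ℝ, 0 < d ∧ ∀ (L : ℝ≥0) (Φ : EuclideanSpace ℝ (Fin n) → EuclideanSpace ℝ (Fin n)),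
      ContDiff ℝ (⊤ : ℕ∞) Φ → LipschitzWith L Φ → (∀ x, dist (Φ x) x ≤ d) →
      ∃ g : EuclideanSpace ℝ (Fin n) → EuclideanSpace ℝ (Fin n),
        ContDiff ℝ (⊤ : ℕ∞) g ∧ IsAdmissibleDeformation G g ∧ LipschitzWith (L + 3) g ∧
        ∀ c ∈ t, EqOn g Φ (closedBall c (r c)) := by
  classical
  obtain ⟨ρ, hρ0, hρG, hρdisj⟩ : ∃ ρ : ℝ, 0 < ρ ∧ (∀ c ∈ t, ball c (r c + ρ) ⊆ G) ∧
      ∀ c ∈ t, ∀ c' ∈ t, c ≠ c' → Disjoint (ball c (r c + ρ)) (ball c' (r c' + ρ)) := by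
    have h1 : ∀ᶠ ρ in 𝓝[>] (0 : ℝ), ∀ c ∈ t, ball c (r c + ρ) ⊆ G := by
      refine (Finset.eventually_all t).2 fun c hc => ?_
      obtain ⟨δ, hδ, hδG⟩ := (isCompact_closedBall c (r c)).exists_thickening_subset_open hG
        (hrG c hc)
      filter_upwards [Ioo_mem_nhdsGT hδ] with ρ hρ
      rw [thickening_closedBall hδ (hr c hc).le] at hδG
      exact (ball_subset_ball (by linarith [hρ.2])).trans hδG
    have h2 : ∀ᶠ ρ in 𝓝[>] (0 : ℝ), ∀ c ∈ t, ∀ c' ∈ t, c ≠ c' →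
        Disjoint (ball c (r c + ρ)) (ball c' (r c' + ρ)) := by
      refine (Finset.eventually_all t).2 fun c hc => (Finset.eventually_all t).2 fun c' hc' => ?_
      by_cases hcc : c = c'
      · exact Filter.Eventually.of_forall fun _ h => absurd hcc h
      have hd := (disjoint_closedBall_closedBall_iff (hr c hc).le (hr c' hc').le).1
        (hdisj hc hc' hcc)
      filter_upwards [Ioo_mem_nhdsGT (show 0 < (dist c c' - (r c + r c')) / 2 by linarith)]
        with ρ hρ _
      exact ball_disjoint_ball (by linarith [hρ.2])
    obtain ⟨ρ, ⟨h1, h2⟩, h3⟩ := ((h1.and h2).and self_mem_nhdsWithin).exists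
    exact ⟨ρ, h3, h1, h2⟩
  have hbump : ∀ c : EuclideanSpace ℝ (Fin n), ∃ χ : EuclideanSpace ℝ (Fin n) → ℝ, ∃ K : ℝ≥0,
      c ∈ t → ContDiff ℝ (⊤ : ℕ∞) χ ∧ LipschitzWith K χ ∧ (∀ x, 0 ≤ χ x) ∧ (∀ x, χ x ≤ 1) ∧
        (∀ x ∈ closedBall c (r c), χ x = 1) ∧ ∀ x, x ∉ ball c (r c + ρ / 2) → χ x = 0 := by
    intro c
    by_cases hc : c ∈ t
    · let f : ContDiffBump c := ⟨r c, r c + ρ / 2, hr c hc, by linarith⟩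
      obtain ⟨K, hK⟩ := ContDiff.lipschitzWith_of_hasCompactSupport
        (f.hasCompactSupport) (f.contDiff (n := (⊤ : ℕ∞))) (by simp)
      refine ⟨f, K, fun _ => ⟨f.contDiff, hK, fun x => f.nonneg, fun x => f.le_one,
        fun x hx => f.one_of_mem_closedBall hx, fun x hx => f.zero_of_le_dist ?_⟩⟩
      exact not_lt.1 hx
    · exact ⟨0, 0, fun h => absurd h hc⟩
  choose χ K hχ using hbump
  set V : EuclideanSpace ℝ (Fin n) → Set (EuclideanSpace ℝ (Fin n)) :=
    fun c => ball c (r c + ρ) with hV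
  set Kt : ℝ≥0 := ∑ c ∈ t, K c with hKt
  set χs : EuclideanSpace ℝ (Fin n) → ℝ := fun x => ∑ c ∈ t, χ c x with hχs
  have hχV : ∀ c ∈ t, ∀ x, x ∉ V c → χ c x = 0 := fun c hc x hx =>
    (hχ c hc).2.2.2.2.2 x fun h => hx (ball_subset_ball (by linarith) h)
  have hχs_eq : ∀ c ∈ t, ∀ x ∈ V c, χs x = χ c x := by
    intro c hc x hx
    refine Finset.sum_eq_single_of_mem c hc fun c' hc' hcc => hχV c' hc' x fun hx' => ?_
    exact (hρdisj c' hc' c hc hcc).ne_of_mem hx' hx rfl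
  have hχs_zero : ∀ x, (∀ c ∈ t, x ∉ V c) → χs x = 0 := fun x hx =>
    Finset.sum_eq_zero fun c hc => hχV c hc x (hx c hc)
  have hχs_mem : ∀ x, 0 ≤ χs x ∧ χs x ≤ 1 := by
    intro x
    by_cases hx : ∃ c ∈ t, x ∈ V c
    · obtain ⟨c, hc, hxc⟩ := hx
      rw [hχs_eq c hc x hxc]
      exact ⟨(hχ c hc).2.2.1 x, (hχ c hc).2.2.2.1 x⟩
    · rw [hχs_zero x fun c hc hxc => hx ⟨c, hc, hxc⟩]
      norm_num
  have hχs_lip : ∀ x y, |χs x - χs y| ≤ Kt * dist x y := by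
    intro x y
    rw [hχs, hKt, ← Finset.sum_sub_distrib, NNReal.coe_sum, Finset.sum_mul]
    refine (Finset.abs_sum_le_sum_abs _ _).trans (Finset.sum_le_sum fun c hc => ?_)
    rw [← Real.dist_eq]
    exact (hχ c hc).2.1.dist_le_mul x y
  refine ⟨min (ρ / 4) (1 / (Kt + 1)), by positivity, fun L Φ hΦ hΦL hΦd => ?_⟩
  set h : EuclideanSpace ℝ (Fin n) → EuclideanSpace ℝ (Fin n) → EuclideanSpace ℝ (Fin n) :=
    fun c x => if c ∈ t then x + χ c x • (Φ x - x) else x with hh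
  have hht : ∀ c ∈ t, h c = fun x => x + χ c x • (Φ x - x) := fun c hc => by
    simp only [hh, hc, if_true]
  have hh_off : ∀ c x, x ∉ V c → h c x = x := by
    intro c x hx
    by_cases hc : c ∈ t
    · rw [hht c hc]
      simp only [hχV c hc x hx, zero_smul, add_zero]
    · simp only [hh, hc, if_false]
  have hh_maps : ∀ c, MapsTo (h c) (V c) (V c) := by
    intro c x hx
    by_cases hc : c ∈ t
    · by_cases hx' : x ∈ ball c (r c + ρ / 2)
      · have h1 : dist (h c x) x ≤ ρ / 4 := by
          rw [hht c hc, dist_eq_norm, add_sub_cancel_left, norm_smul, ← dist_eq_norm,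
            Real.norm_of_nonneg ((hχ c hc).2.2.1 x)]
          exact (mul_le_of_le_one_left dist_nonneg ((hχ c hc).2.2.2.1 x)).trans
            ((hΦd x).trans (min_le_left _ _))
        have h2 := dist_triangle (h c x) x c
        rw [mem_ball] at hx'
        exact mem_ball.2 (by linarith)
      · rw [hht c hc]
        simp only [(hχ c hc).2.2.2.2.2 x hx', zero_smul, add_zero]
        exact hx
    · simp only [hh, hc, if_false]
      exact hx
  have hh_smooth : ∀ c ∈ t, ContDiff ℝ (⊤ : ℕ∞) (h c) := by
    intro c hc
    rw [hht c hc]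
    exact contDiff_id.add ((hχ c hc).1.smul (hΦ.sub contDiff_id))
  have hpair : t.toList.Pairwise fun c c' => Disjoint (V c) (V c') := by
    refine List.Pairwise.imp_of_mem ?_ t.nodup_toList
    intro c c' hc hc' hcc
    exact hρdisj c (Finset.mem_toList.1 hc) c' (Finset.mem_toList.1 hc') hcc
  set g := (t.toList.map h).foldr (· ∘ ·) id with hg
  have hg_eq : ∀ x, g x = x + χs x • (Φ x - x) := by
    intro x
    obtain ⟨h1, h2⟩ := foldr_comp_apply_of_pairwise_disjoint hh_off hh_maps t.toList hpair x
    by_cases hx : ∃ c ∈ t, x ∈ V c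
    · obtain ⟨c, hc, hxc⟩ := hx
      rw [hg, h2 c (Finset.mem_toList.2 hc) hxc, hχs_eq c hc x hxc, hht c hc]
    · rw [hg, h1 fun c hc hxc => hx ⟨c, Finset.mem_toList.1 hc, hxc⟩,
        hχs_zero x fun c hc hxc => hx ⟨c, hc, hxc⟩, zero_smul, add_zero]
  refine ⟨g, contDiff_foldr_comp _ ?_, ⟨t.toList.map h, ?_, rfl⟩, ?_, ?_⟩
  · intro f hf
    obtain ⟨c, hc, rfl⟩ := List.mem_map.1 hf
    exact hh_smooth c (Finset.mem_toList.1 hc)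
  · intro f hf
    obtain ⟨c, hc, rfl⟩ := List.mem_map.1 hf
    have hc' := Finset.mem_toList.1 hc
    exact ⟨(hh_smooth c hc').of_le (by simp), V c, isOpen_ball, convex_ball _ _, isBounded_ball,
      hρG c hc', hh_off c, (hh_maps c).image_subset⟩
  · refine LipschitzWith.of_dist_le_mul fun x y => ?_
    have e1 : g x - g y = (x - y) + χs x • ((Φ x - Φ y) - (x - y)) +
        (χs x - χs y) • (Φ y - y) := by
      rw [hg_eq, hg_eq]
      module
    have b1 : ‖(Φ x - Φ y) - (x - y)‖ ≤ (L + 1) * dist x y := by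
      refine (norm_sub_le _ _).trans ?_
      rw [← dist_eq_norm, ← dist_eq_norm]
      linarith [hΦL.dist_le_mul x y]
    have b2 : ‖χs x • ((Φ x - Φ y) - (x - y))‖ ≤ (L + 1) * dist x y := by
      rw [norm_smul, Real.norm_of_nonneg (hχs_mem x).1]
      exact (mul_le_of_le_one_left (norm_nonneg _) (hχs_mem x).2).trans b1
    have b3 : ‖(χs x - χs y) • (Φ y - y)‖ ≤ 1 * dist x y := by
      rw [norm_smul, Real.norm_eq_abs, ← dist_eq_norm]
      have hd : dist (Φ y) y ≤ 1 / (Kt + 1) := (hΦd y).trans (min_le_right _ _)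
      calc |χs x - χs y| * dist (Φ y) y ≤ (Kt * dist x y) * (1 / (Kt + 1)) := by
            gcongr
            exact hχs_lip x y
        _ = Kt / (Kt + 1) * dist x y := by ring
        _ ≤ 1 * dist x y := by
            gcongr
            rw [div_le_one (by positivity)]
            linarith
    rw [dist_eq_norm, e1]
    have b4 := norm_add₃_le (a := x - y) (b := χs x • ((Φ x - Φ y) - (x - y)))
      (c := (χs x - χs y) • (Φ y - y))
    rw [← dist_eq_norm x y] at b4
    push_cast
    linarith
  · intro c hc x hx
    have hxV : x ∈ V c := closedBall_subset_ball (by linarith) hx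
    rw [hg_eq, hχs_eq c hc x hxV, (hχ c hc).2.2.2.2.1 x hx, one_smul, add_sub_cancel]

theorem exists_embedding_subset_range {n k : ℕ} (hk : k ≤ n) {s : Finset (Fin n)}
    (hs : s.card ≤ k) : ∃ I : Fin k ↪ Fin n, (s : Set (Fin n)) ⊆ range I := by
  obtain ⟨t, hst, -, htk⟩ := Finset.exists_subsuperset_card_eq (Finset.subset_univ s) hs
    (by simpa using hk)
  refine ⟨(t.orderEmbOfFin htk).toEmbedding, ?_⟩
  rw [RelEmbedding.coe_toEmbedding, Finset.range_orderEmbOfFin]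
  exact_mod_cast hst

theorem hausdorffMeasure_fin_eq_zero_of_lt {k m : ℕ} (hk : k < m) (s : Set (Fin k → ℝ)) :
    μH[(m : ℝ)] s = 0 := by
  refine measure_mono_null (subset_univ s) ?_
  have := hausdorffMeasure_of_dimH_lt (s := (univ : Set (Fin k → ℝ))) (d := m)
    (by rw [Real.dimH_univ_pi_fin]; exact_mod_cast hk)
  exact_mod_cast this

/-- The points with at most `k` non-collapsed coordinates have a null image, provided all
projections to `k` coordinates are null. -/
theorem hausdorffMeasure_conj_gridMap_image_eq_zero {n k : ℕ} (hk : k ≤ n) {d : ℝ} (hd : 0 ≤ d)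
    {η : ℝ≥0} (hη : 0 < η) (hη1 : η < 1) {δ : ℝ} (hδ : 0 < δ) (τ : Fin n → ℝ)
    (A : EuclideanSpace ℝ (Fin n) ≃L[ℝ] (Fin n → ℝ)) {E : Set (EuclideanSpace ℝ (Fin n))}
    (hE : ∀ I : Fin k ↪ Fin n, μH[d] ((fun x (i : Fin k) => A x (I i)) '' E) = 0) :
    μH[d] ((fun x => A.symm (gridMap η δ τ (A x))) ''
      {x ∈ E | (gridIndices η ((fun i => A x i / δ) + τ)).card ≤ k}) = 0 := by
  set EI : (Fin k ↪ Fin n) → Set (EuclideanSpace ℝ (Fin n)) := fun I =>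
    {x ∈ E | ∀ i ∉ range I, (η : ℝ) ≤ Int.fract (A x i / δ + τ i)} with hEI
  have hsub : {x ∈ E | (gridIndices η ((fun i => A x i / δ) + τ)).card ≤ k} ⊆ ⋃ I, EI I := by
    rintro x ⟨hxE, hx⟩
    obtain ⟨I, hI⟩ := exists_embedding_subset_range hk hx
    refine mem_iUnion.2 ⟨I, hxE, fun i hi => ?_⟩
    by_contra h
    exact hi (hI (by simpa [gridIndices] using h))
  refine measure_mono_null (image_mono hsub) ?_
  rw [image_iUnion]
  refine measure_iUnion_null fun I => ?_
  have h1 : μH[d] (gridMap η δ τ '' (A '' EI I)) = 0 := by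
    refine hausdorffMeasure_gridMap_image_eq_zero hd hη hη1 hδ τ I ?_ ?_
    · rintro _ ⟨x, hx, rfl⟩
      exact hx.2
    · rw [image_image]
      exact measure_mono_null (image_mono fun x hx => hx.1) (hE I)
  have h2 : (fun x => A.symm (gridMap η δ τ (A x))) '' EI I =
      A.symm '' (gridMap η δ τ '' (A '' EI I)) := by
    rw [image_image, image_image]
  rw [h2]
  refine le_antisymm ((A.symm.lipschitz.hausdorffMeasure_image_le hd _).trans ?_) (zero_le)
  rw [h1, mul_zero]

/-- A set of finite measure in an open set is covered, up to small measure, by finitely many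
disjoint closed balls in that open set. -/
theorem exists_finset_disjoint_closedBall_measure_diff_le {n : ℕ}
    {G T : Set (EuclideanSpace ℝ (Fin n))} (hG : IsOpen G) (hTG : T ⊆ G)
    (hT : MeasurableSet T) {μ : Measure (EuclideanSpace ℝ (Fin n))} (hfin : μ T ≠ ∞)
    {θ : ℝ≥0∞} (hθ : θ ≠ 0) :
    ∃ (t : Finset (EuclideanSpace ℝ (Fin n))) (r : EuclideanSpace ℝ (Fin n) → ℝ),
      (∀ c ∈ t, 0 < r c) ∧ (∀ c ∈ t, closedBall c (r c) ⊆ G) ∧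
      (t : Set (EuclideanSpace ℝ (Fin n))).PairwiseDisjoint (fun c => closedBall c (r c)) ∧
      μ (T \ ⋃ c ∈ t, closedBall c (r c)) ≤ θ := by
  classical
  have : IsFiniteMeasure (μ.restrict T) := isFiniteMeasure_restrict.2 hfin
  have hR : ∀ x, ∃ R : ℝ, x ∈ T → 0 < R ∧ closedBall x R ⊆ G := by
    intro x
    by_cases hx : x ∈ T
    · obtain ⟨R, hR, h⟩ := Metric.nhds_basis_closedBall.mem_iff.1 (hG.mem_nhds (hTG hx))
      exact ⟨R, fun _ => ⟨hR, h⟩⟩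
    · exact ⟨0, fun h => absurd h hx⟩
  choose R hR using hR
  obtain ⟨t, r, htc, htT, hr, hcov, hdisj⟩ :=
    Besicovitch.exists_disjoint_closedBall_covering_ae (μ.restrict T) (fun _ => univ) T
      (fun x _ δ hδ => by simpa using hδ) R (fun x hx => (hR x hx).1)
  have := htc.to_subtype
  have hsum : ∑' c : t, (μ.restrict T) (closedBall (c : EuclideanSpace ℝ (Fin n)) (r c)) ≠ ∞ := by
    rw [← measure_biUnion htc hdisj fun c _ => measurableSet_closedBall]
    exact measure_ne_top _ _
  have htail := ENNReal.tendsto_tsum_compl_atTop_zero hsum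
  obtain ⟨s, hs⟩ := (htail.eventually (gt_mem_nhds (pos_iff_ne_zero.2 hθ))).exists
  have hst : ∀ c ∈ s.image Subtype.val, c ∈ t := by
    intro c hc
    obtain ⟨c', -, rfl⟩ := Finset.mem_image.1 hc
    exact c'.2
  refine ⟨s.image Subtype.val, r, fun c hc => (hr c (hst c hc)).2.1, fun c hc => ?_,
    hdisj.subset hst, ?_⟩
  · exact (closedBall_subset_closedBall (hr c (hst c hc)).2.2.le).trans
      (hR c (htT (hst c hc))).2
  · have hsub : T \ ⋃ c ∈ s.image Subtype.val, closedBall c (r c) ⊆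
        (T \ ⋃ c ∈ t, closedBall c (r c)) ∪
          ((⋃ c : {c : t // c ∉ s}, closedBall (c : EuclideanSpace ℝ (Fin n)) (r c)) ∩ T) := by
      rintro x ⟨hxT, hx⟩
      by_cases hxt : x ∈ ⋃ c ∈ t, closedBall c (r c)
      · obtain ⟨c, hc, hxc⟩ := mem_iUnion₂.1 hxt
        refine Or.inr ⟨mem_iUnion.2 ⟨⟨⟨c, hc⟩, fun h => hx ?_⟩, hxc⟩, hxT⟩
        exact mem_iUnion₂.2 ⟨c, Finset.mem_image.2 ⟨⟨c, hc⟩, h, rfl⟩, hxc⟩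
      · exact Or.inl ⟨hxT, hxt⟩
    have hcov' : μ (T \ ⋃ c ∈ t, closedBall c (r c)) = 0 := by
      have hm : MeasurableSet (T \ ⋃ c ∈ t, closedBall c (r c)) :=
        hT.diff (MeasurableSet.biUnion htc fun c _ => measurableSet_closedBall)
      rwa [Measure.restrict_apply hm, inter_eq_left.2 sdiff_subset] at hcov
    calc μ (T \ ⋃ c ∈ s.image Subtype.val, closedBall c (r c))
        ≤ _ := measure_mono hsub
      _ ≤ _ := measure_union_le _ _
      _ = (μ.restrict T)
          (⋃ c : {c : t // c ∉ s}, closedBall (c : EuclideanSpace ℝ (Fin n)) (r c)) := by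
        rw [hcov', zero_add, Measure.restrict_apply
          (MeasurableSet.iUnion fun _ => measurableSet_closedBall)]
      _ ≤ ∑' c : {c : t // c ∉ s},
          (μ.restrict T) (closedBall (c : EuclideanSpace ℝ (Fin n)) (r c)) := measure_iUnion_le _
      _ ≤ θ := hs.le

theorem hausdorffMeasure_image_le_of_cover {X : Type*} [MetricSpace X] [MeasurableSpace X]
    [BorelSpace X] {m : ℕ} {g Φ : X → X} {C : ℝ≥0} (hg : LipschitzWith C g) {E U B : Set X}
    (hU : EqOn g Φ U) (h0 : μH[(m : ℝ)] (Φ '' (E \ B)) = 0) {a b : ℝ≥0∞}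
    (hB : μH[(m : ℝ)] (E ∩ B) ≤ a) (hEU : μH[(m : ℝ)] (E \ U) ≤ b) :
    μH[(m : ℝ)] (g '' E) ≤ C ^ m * a + C ^ m * b := by
  have hlip : ∀ F, μH[(m : ℝ)] (g '' F) ≤ C ^ m * μH[(m : ℝ)] F := by
    intro F
    have := hg.hausdorffMeasure_image_le (d := m) (by positivity) F
    rwa [ENNReal.rpow_natCast] at this
  have hsub : E ⊆ ((E \ B) ∩ U) ∪ ((E ∩ B) ∪ (E \ U)) := by
    intro x hx
    by_cases hxB : x ∈ B <;> by_cases hxU : x ∈ U <;> simp [hx, hxB, hxU]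
  calc μH[(m : ℝ)] (g '' E)
      ≤ μH[(m : ℝ)] (g '' (((E \ B) ∩ U) ∪ ((E ∩ B) ∪ (E \ U)))) := measure_mono (image_mono hsub)
    _ ≤ μH[(m : ℝ)] (g '' ((E \ B) ∩ U)) +
          (μH[(m : ℝ)] (g '' (E ∩ B)) + μH[(m : ℝ)] (g '' (E \ U))) := by
        rw [image_union, image_union]
        exact (measure_union_le _ _).trans (add_le_add le_rfl (measure_union_le _ _))
    _ ≤ 0 + (C ^ m * a + C ^ m * b) := by
        refine add_le_add (le_of_eq ?_) (add_le_add ?_ ?_)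
        · rw [(hU.mono inter_subset_right).image_eq]
          exact measure_mono_null (image_mono inter_subset_left) h0
        · exact (hlip _).trans (by gcongr)
        · exact (hlip _).trans (by gcongr)
    _ = _ := zero_add _

/-- The constants in the main theorem: `η` is the width of the non-collapsed part of the grid, `C`
bounds the Lipschitz constants and `κ` the part of the sets that is not controlled. -/
theorem exists_grid_constants {n m : ℕ} {Λ ε : ℝ≥0} (hΛ : Λ ≠ 0) (hε : 0 < ε) :
    ∃ η κ : ℝ≥0, 0 < η ∧ η < 1 ∧ 0 < κ ∧
      (Λ / η) ^ m * (2 * (2 ^ n * (2 * η) ^ (m + 1))) + (Λ / η) ^ m * κ ≤ ε ∧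
      (Λ / η) ^ m * (2 * (2 ^ n * (2 * η) ^ m)) + (Λ / η) ^ m * κ ≤
        (2 * Λ) ^ m * (2 * 2 ^ n) + 1 := by
  set D : ℝ≥0 := (2 * Λ) ^ m * (2 * 2 ^ n) with hD
  set η : ℝ≥0 := min (1 / 2) (ε / (4 * (D + 1))) with hη
  have hη0 : 0 < η := lt_min (by norm_num) (by positivity)
  have hηε : D * (2 * η) ≤ ε / 2 := by
    calc D * (2 * η) ≤ (D + 1) * (2 * (ε / (4 * (D + 1)))) := by
          gcongr
          · exact le_self_add
          · exact min_le_right _ _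
      _ = ε / 2 := by field_simp; norm_num
  have hC : (Λ / η) ^ m ≠ 0 := pow_ne_zero _ (div_ne_zero hΛ hη0.ne')
  have hmain : (Λ / η) ^ m * (2 * (2 ^ n * (2 * η) ^ m)) = D := by
    rw [hD, div_pow, mul_pow, mul_pow]
    field_simp
  refine ⟨η, min (ε / 2) 1 / (Λ / η) ^ m, hη0, (min_le_left _ _).trans_lt (by
    rw [← NNReal.coe_lt_coe]; norm_num), ?_, ?_, ?_⟩
  · exact div_pos (lt_min (by positivity) one_pos) (pos_iff_ne_zero.2 hC)
  · rw [mul_div_cancel₀ _ hC]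
    have : (Λ / η) ^ m * (2 * (2 ^ n * (2 * η) ^ (m + 1))) = D * (2 * η) := by
      rw [← hmain]; ring
    rw [this]
    calc D * (2 * η) + min (ε / 2) 1 ≤ ε / 2 + ε / 2 := add_le_add hηε (min_le_left _ _)
      _ = ε := add_halves ε
  · rw [mul_div_cancel₀ _ hC, hmain]
    gcongr
    exact min_le_right _ _

theorem kill_unrectifiable_part (n m : ℕ) (hm : 1 ≤ m) (hmn : m < n) :
    ∃ Γ : ℝ, 1 ≤ Γ ∧
      ∀ (G : Set (EuclideanSpace ℝ (Fin n))), IsOpen G → Bornology.IsBounded G →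
      ∀ (S : Set (EuclideanSpace ℝ (Fin n))), IsClosed S →
        μH[(m : ℝ)] (S ∩ G) < ⊤ → μH[(m : ℝ)] (S ∩ frontier G) = 0 →
      ∀ ε : ℝ, 0 < ε →
      ∀ (Su Sr : Set (EuclideanSpace ℝ (Fin n))),
        S ∩ G = Su ∪ Sr → Disjoint Su Sr →
        PurelyUnrectifiable m Su → CountablyRectifiable m Sr →
        ∃ g : EuclideanSpace ℝ (Fin n) → EuclideanSpace ℝ (Fin n),
          ContDiff ℝ (⊤ : ℕ∞) g ∧
          IsAdmissibleDeformation G g ∧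
          μH[(m : ℝ)] (g '' Su) ≤ ENNReal.ofReal ε * μH[(m : ℝ)] Su ∧
          μH[(m : ℝ)] (g '' Sr) ≤ ENNReal.ofReal Γ * μH[(m : ℝ)] Sr := by
  have hn : 0 < n := by omega
  obtain ⟨K, hK⟩ := exists_norm_deriv_smoothTransition_le
  set Λ : ℝ≥0 := 2 * n * (K * 2) + 3 with hΛ
  have hΛ0 : Λ ≠ 0 := by positivity
  refine ⟨((2 * Λ) ^ m * (2 * 2 ^ n) + 1 : ℝ≥0), by push_cast; simp, ?_⟩
  intro G hG _ S hS hfin _ ε hε Su Sr hSuSr _ hSu hSr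
  have hT : MeasurableSet (S ∩ G) := hS.measurableSet.inter hG.measurableSet
  have hSuT : Su ⊆ S ∩ G := hSuSr ▸ subset_union_left
  have hSrT : Sr ⊆ S ∩ G := hSuSr ▸ subset_union_right
  have hSu_fin : μH[(m : ℝ)] Su ≠ ∞ := measure_ne_top_of_subset hSuT hfin.ne
  have hSr_fin : μH[(m : ℝ)] Sr ≠ ∞ := measure_ne_top_of_subset hSrT hfin.ne
  obtain ⟨M, hM, hMI⟩ := exists_matrix_near_one_volume_image_eq_zero hm hT hfin.ne hSuSr hSu hSr
    (show (0 : ℝ) < 1 / (2 * n) by positivity)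
  obtain ⟨A, hAM, hA, hA'⟩ := exists_continuousLinearEquiv_of_near_one hn hM
  obtain ⟨η, κ, hη0, hη1, hκ, hεbound, hΓbound⟩ :=
    exists_grid_constants (n := n) (m := m) hΛ0 (Real.toNNReal_pos.2 hε)
  set C : ℝ≥0 := Λ / η with hC
  set w : Set (EuclideanSpace ℝ (Fin n)) → ℝ≥0∞ := fun E =>
    if μH[(m : ℝ)] E = 0 then 1 else κ * μH[(m : ℝ)] E with hw
  have hw0 : ∀ E, w E ≠ 0 := by
    intro E
    simp only [hw]
    split_ifs with h
    · exact one_ne_zero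
    · exact mul_ne_zero (by exact_mod_cast hκ.ne') h
  obtain ⟨t, r, hr, hrG, hdisj, hrest⟩ := exists_finset_disjoint_closedBall_measure_diff_le hG
    inter_subset_right hT hfin.ne (θ := min (w Su) (w Sr))
    (lt_min (pos_iff_ne_zero.2 (hw0 _)) (pos_iff_ne_zero.2 (hw0 _))).ne'
  set U : Set (EuclideanSpace ℝ (Fin n)) := ⋃ c ∈ t, closedBall c (r c) with hU
  have hsmall : ∀ E ⊆ S ∩ G, μH[(m : ℝ)] ((S ∩ G) \ U) ≤ w E →
      μH[(m : ℝ)] (E \ U) ≤ κ * μH[(m : ℝ)] E := by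
    intro E hE hwE
    by_cases h : μH[(m : ℝ)] E = 0
    · rw [measure_mono_null sdiff_subset h]
      exact zero_le
    · simp only [hw, h, if_false] at hwE
      exact (measure_mono (sdiff_subset_sdiff_left hE)).trans hwE
  obtain ⟨d, hd, hdef⟩ := exists_isAdmissibleDeformation_eqOn_closedBall hG t hr hrG hdisj
  set δ : ℝ := d / (2 * n) with hδ
  have hδ0 : 0 < δ := by positivity
  set y : EuclideanSpace ℝ (Fin n) → Fin n → ℝ := fun x i => A x i / δ with hy
  have hymeas : Measurable y := by
    refine measurable_pi_lambda _ fun i => Measurable.div_const ?_ _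
    exact (measurable_pi_apply i).comp A.continuous.measurable
  have hνu : IsFiniteMeasure (μH[(m : ℝ)].restrict Su) := isFiniteMeasure_restrict.2 hSu_fin
  have hνr : IsFiniteMeasure (μH[(m : ℝ)].restrict Sr) := isFiniteMeasure_restrict.2 hSr_fin
  have := isProbabilityMeasure_cubeMeasure n
  obtain ⟨hfu, hfu'⟩ := lintegral_measure_le_card_gridIndices (μH[(m : ℝ)].restrict Su) hymeas
    η.coe_nonneg (m + 1)
  obtain ⟨hfr, hfr'⟩ := lintegral_measure_le_card_gridIndices (μH[(m : ℝ)].restrict Sr) hymeas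
    η.coe_nonneg m
  obtain ⟨τ, hτu, hτr⟩ := exists_le_two_mul_and_le_two_mul (cubeMeasure n) hfu hfr
    (by finiteness) (by finiteness) hfu' hfr'
  have hBmeas : ∀ k, MeasurableSet {x | k ≤ (gridIndices η (y x + τ)).card} := fun k =>
    (hymeas.add_const τ) (measurableSet_le_card_gridIndices η k)
  have h2η : ENNReal.ofReal (2 * η) = ((2 * η : ℝ≥0) : ℝ≥0∞) := by
    rw [← ENNReal.ofReal_coe_nnreal]
    simp
  rw [Measure.restrict_apply (hBmeas _), Measure.restrict_apply_univ, inter_comm, h2η] at hτu hτr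
  set Φ : EuclideanSpace ℝ (Fin n) → EuclideanSpace ℝ (Fin n) := fun x =>
    A.symm (gridMap η δ τ (A x)) with hΦ
  have hΦsmooth : ContDiff ℝ (⊤ : ℕ∞) Φ :=
    A.symm.contDiff.comp ((contDiff_gridMap hη0 hη1 δ τ).comp A.contDiff)
  have hΦlip : LipschitzWith (2 * n * (K / η * 2)) Φ :=
    hA'.comp ((lipschitzWith_gridMap hη0 hη1 hK hδ0 τ).comp hA)
  have hΦd : ∀ x, dist (Φ x) x ≤ d := by
    intro x
    have h1 := hA'.dist_le_mul (gridMap η δ τ (A x)) (A x)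
    rw [A.symm_apply_apply] at h1
    refine h1.trans ?_
    calc ((2 * n : ℝ≥0) : ℝ) * dist (gridMap η δ τ (A x)) (A x) ≤ (2 * n : ℝ≥0) * δ := by
          gcongr
          exact dist_gridMap_self_le _ hδ0 _ _
      _ = d := by
          push_cast
          rw [hδ]
          field_simp
  obtain ⟨g, hg, hgG, hglip, hgeq⟩ := hdef _ Φ hΦsmooth hΦlip hΦd
  have hgC : LipschitzWith C g := by
    refine hglip.weaken ?_
    have h3 : (3 : ℝ≥0) ≤ 3 / η := by
      rw [le_div_iff₀ hη0]
      exact mul_le_of_le_one_right (zero_le) hη1.le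
    calc 2 * n * (K / η * 2) + 3 ≤ 2 * n * (K / η * 2) + 3 / η := by gcongr
      _ = C := by rw [hC, hΛ]; ring
  have hgU : EqOn g Φ U := by
    intro x hx
    obtain ⟨c, hc, hxc⟩ := mem_iUnion₂.1 hx
    exact hgeq c hc hxc
  have hnull_u : μH[(m : ℝ)] (Φ '' (Su \ {x | m + 1 ≤ (gridIndices η (y x + τ)).card})) = 0 := by
    have heq : Su \ {x | m + 1 ≤ (gridIndices η (y x + τ)).card} =
        {x ∈ Su | (gridIndices η (y x + τ)).card ≤ m} := by
      ext x
      simp only [mem_sdiff, mem_ofPred_eq, not_le, Nat.lt_succ_iff]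
    rw [heq]
    refine hausdorffMeasure_conj_gridMap_image_eq_zero hmn.le (by positivity) hη0 hη1 hδ0 τ A
      fun I => ?_
    rw [hausdorffMeasure_fin_real]
    convert hMI I using 4 with x
    rw [hAM]
    rfl
  have hnull_r : μH[(m : ℝ)] (Φ '' (Sr \ {x | m ≤ (gridIndices η (y x + τ)).card})) = 0 := by
    have heq : Sr \ {x | m ≤ (gridIndices η (y x + τ)).card} =
        {x ∈ Sr | (gridIndices η (y x + τ)).card ≤ m - 1} := by
      ext x
      simp only [mem_sdiff, mem_ofPred_eq, not_le, Nat.lt_iff_le_pred hm]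
    rw [heq]
    exact hausdorffMeasure_conj_gridMap_image_eq_zero (by omega) (by positivity) hη0 hη1 hδ0 τ A
      fun I => hausdorffMeasure_fin_eq_zero_of_lt (by omega) _
  refine ⟨g, hg, hgG, ?_, ?_⟩
  · refine (hausdorffMeasure_image_le_of_cover hgC hgU hnull_u hτu
      (hsmall Su hSuT (hrest.trans (min_le_left _ _)))).trans ?_
    calc _ = ((C ^ m * (2 * (2 ^ n * (2 * η) ^ (m + 1))) + C ^ m * κ : ℝ≥0) : ℝ≥0∞) *
          μH[(m : ℝ)] Su := by push_cast; ring
      _ ≤ _ := by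
        gcongr
        exact ENNReal.coe_le_coe.2 hεbound
  · refine (hausdorffMeasure_image_le_of_cover hgC hgU hnull_r hτr
      (hsmall Sr hSrT (hrest.trans (min_le_right _ _)))).trans ?_
    rw [ENNReal.ofReal_coe_nnreal]
    calc _ = ((C ^ m * (2 * (2 ^ n * (2 * η) ^ m)) + C ^ m * κ : ℝ≥0) : ℝ≥0∞) *
          μH[(m : ℝ)] Sr := by push_cast; ring
      _ ≤ _ := by
        gcongr
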